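/- There exists a constant c > 0 and a bijection f : ℕ+ → ℕ+ such that f(n) ∣ f(n+1) or f(n+1) ∣ f(n) for all n, and f(n) ≤ c · n · (log n)² for all n ≥ 2. -/

import Mathlib

open scoped ENNReal

open Finset in
theorem sum_vonMangoldt_div_bounds {N : ℕ} (hN : 0 < N) :
    Real.log N - 1 ≤ ∑ d ∈ Ioc 0 N, ArithmeticFunction.vonMangoldt d / d ∧
      ∑ d ∈ Ioc 0 N, ArithmeticFunction.vonMangoldt d / d ≤ Real.log N + 6 := by
  have hN' : (0 : ℝ) < N := by exact_mod_cast hN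
  have hfac : Real.log (N.factorial) =
      ∑ d ∈ Ioc 0 N, ArithmeticFunction.vonMangoldt d * ((N / d : ℕ) : ℝ) := by
    have h := ArithmeticFunction.sum_Ioc_mul_zeta_eq_sum ArithmeticFunction.vonMangoldt N
    rw [ArithmeticFunction.vonMangoldt_mul_zeta] at h
    rw [← h, ← prod_Ico_id_eq_factorial, Nat.cast_prod, Real.log_prod]
    · rfl
    · intro i hi
      have := (mem_Ico.1 hi).1
      positivity
  have hlow : (N : ℝ) * Real.log N - N ≤ Real.log (N.factorial) := by
    have h := Stirling.le_log_factorial_stirling hN.ne'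
    have h1 : 0 ≤ Real.log N := Real.log_nonneg (by exact_mod_cast hN)
    have h2 : 0 ≤ Real.log (2 * Real.pi) :=
      Real.log_nonneg (by linarith [Real.pi_gt_three])
    linarith
  have hupp : Real.log (N.factorial) ≤ N * Real.log N := by
    rw [← Real.log_pow]
    exact Real.log_le_log (by positivity) (by exact_mod_cast Nat.factorial_le_pow N)
  have hdiv (d : ℕ) (hd : d ∈ Ioc 0 N) :
      (N : ℝ) / d - 1 ≤ ((N / d : ℕ) : ℝ) ∧ ((N / d : ℕ) : ℝ) ≤ N / d := by
    refine ⟨?_, Nat.cast_div_le⟩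
    have h := Nat.lt_floor_add_one ((N : ℝ) / d)
    rw [Nat.floor_div_natCast, Nat.floor_natCast] at h
    linarith
  have hmul : (N : ℝ) * ∑ d ∈ Ioc 0 N, ArithmeticFunction.vonMangoldt d / d =
      ∑ d ∈ Ioc 0 N, ArithmeticFunction.vonMangoldt d * ((N : ℝ) / d) := by
    rw [mul_sum]
    exact sum_congr rfl fun d _ ↦ by ring
  have h1 : Real.log (N.factorial) ≤
      N * ∑ d ∈ Ioc 0 N, ArithmeticFunction.vonMangoldt d / d := by
    rw [hmul, hfac]
    exact sum_le_sum fun d hd ↦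
      mul_le_mul_of_nonneg_left (hdiv d hd).2 ArithmeticFunction.vonMangoldt_nonneg
  have h2 : N * ∑ d ∈ Ioc 0 N, ArithmeticFunction.vonMangoldt d / d ≤
      Real.log (N.factorial) + 6 * N := by
    have hpsi : ∑ d ∈ Ioc 0 N, ArithmeticFunction.vonMangoldt d ≤ 6 * N := by
      have h := Chebyshev.psi_le_const_mul_self hN'.le
      have h4 : Real.log 4 < 2 := by
        rw [show (4 : ℝ) = 2 ^ 2 by norm_num, Real.log_pow]
        have := Real.log_two_lt_d9
        push_cast
        linarith
      rw [Chebyshev.psi, Nat.floor_natCast] at h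
      nlinarith
    calc _ = ∑ d ∈ Ioc 0 N, ArithmeticFunction.vonMangoldt d * ((N : ℝ) / d) := hmul
      _ ≤ ∑ d ∈ Ioc 0 N, (ArithmeticFunction.vonMangoldt d * ((N / d : ℕ) : ℝ) +
            ArithmeticFunction.vonMangoldt d) := by
        refine sum_le_sum fun d hd ↦ ?_
        have := mul_le_mul_of_nonneg_left (hdiv d hd).1
          (ArithmeticFunction.vonMangoldt_nonneg (n := d))
        linarith
      _ ≤ _ := by rw [sum_add_distrib, hfac]; linarith
  constructor
  · nlinarith [h1, hlow]
  · nlinarith [h2, hupp]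

open Finset in
theorem sum_vonMangoldt_div_le {y : ℝ} (hy : 1 ≤ y) :
    ∑ d ∈ Ioc 0 ⌊y⌋₊, ArithmeticFunction.vonMangoldt d / d ≤ Real.log y + 6 := by
  have h : 0 < ⌊y⌋₊ := Nat.floor_pos.2 hy
  refine (sum_vonMangoldt_div_bounds h).2.trans ?_
  gcongr
  exact Nat.floor_le (by linarith)

theorem exists_sum_vonMangoldt_div_not_prime_le :
    ∃ C : ℝ, 0 ≤ C ∧ ∀ S : Finset ℕ, (∀ d ∈ S, ¬ d.Prime) →
      ∑ d ∈ S, ArithmeticFunction.vonMangoldt d / d ≤ C := by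
  have h := ArithmeticFunction.vonMangoldt.summable_residueClass_non_primes_div (0 : ZMod 1)
  have h0 (n : ℕ) : 0 ≤ (if n.Prime then 0 else
      ArithmeticFunction.vonMangoldt.residueClass (0 : ZMod 1) n) / n := by
    positivity [ArithmeticFunction.vonMangoldt.residueClass_nonneg (0 : ZMod 1) n]
  refine ⟨_, tsum_nonneg h0, fun S hS ↦ le_trans (le_of_eq ?_) (h.sum_le_tsum S fun i _ ↦ h0 i)⟩
  refine Finset.sum_congr rfl fun d hd ↦ ?_
  rw [if_neg (hS d hd), ArithmeticFunction.vonMangoldt.residueClass, Set.indicator_of_mem]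
  exact Subsingleton.elim (α := ZMod 1) _ _

open Finset in
theorem exists_le_sum_log_prime_div :
    ∃ C : ℝ, 0 ≤ C ∧ ∀ y : ℝ, 1 ≤ y →
      Real.log y - C ≤ ∑ p ∈ Ioc 2 ⌊y⌋₊ with p.Prime, Real.log p / p := by
  obtain ⟨C, hC, h⟩ := exists_sum_vonMangoldt_div_not_prime_le
  have hl2 := Real.log_two_lt_d9
  refine ⟨C + 3, by linarith, fun y hy ↦ ?_⟩
  have hf : 0 < ⌊y⌋₊ := Nat.floor_pos.2 hy
  have h1 := (sum_vonMangoldt_div_bounds hf).1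
  have h2 : Real.log y ≤ Real.log ⌊y⌋₊ + Real.log 2 := by
    rw [← Real.log_mul (by positivity) (by norm_num)]
    refine Real.log_le_log (by linarith) ?_
    have := Nat.lt_floor_add_one y
    have h3 : (1 : ℝ) ≤ ⌊y⌋₊ := by exact_mod_cast hf
    linarith
  have h3 := h {d ∈ Ioc 0 ⌊y⌋₊ | ¬ d.Prime} (by simp)
  rw [← sum_filter_add_sum_filter_not (Ioc 0 ⌊y⌋₊) Nat.Prime] at h1
  have h4 : ∑ d ∈ Ioc 0 ⌊y⌋₊ with d.Prime, ArithmeticFunction.vonMangoldt d / d ≤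
      (∑ p ∈ Ioc 2 ⌊y⌋₊ with p.Prime, Real.log p / p) + 1 := by
    have hsub : {d ∈ Ioc 0 ⌊y⌋₊ | d.Prime} ⊆ insert 2 {d ∈ Ioc 2 ⌊y⌋₊ | d.Prime} := by
      intro d hd
      simp only [mem_filter, mem_Ioc, mem_insert] at hd ⊢
      have := hd.2.two_le
      by_cases d = 2
      · left; assumption
      · right; exact ⟨⟨by omega, hd.1.2⟩, hd.2⟩
    calc _ = ∑ d ∈ Ioc 0 ⌊y⌋₊ with d.Prime, Real.log d / d :=
          sum_congr rfl fun d hd ↦ by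
            rw [ArithmeticFunction.vonMangoldt_apply_prime (mem_filter.1 hd).2]
      _ ≤ ∑ d ∈ insert 2 {d ∈ Ioc 2 ⌊y⌋₊ | d.Prime}, Real.log d / d :=
          sum_le_sum_of_subset_of_nonneg hsub fun d _ _ ↦
            div_nonneg (Real.log_natCast_nonneg d) (Nat.cast_nonneg d)
      _ ≤ _ := by
          rw [sum_insert (by simp)]
          push_cast
          linarith
  linarith

/-- All prime factors of `r` exceed `y`. -/
def IsRough (y r : ℕ) : Prop := r ≠ 0 ∧ ∀ p, p.Prime → p ∣ r → y < p

/-- `m` is odd and each prime `p ∣ m` is at most `t` times a divisor of `m` all of whose prime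
factors are less than `p`. -/
def IsGapDense (t m : ℕ) : Prop :=
  IsRough 2 m ∧ ∀ p, p.Prime → p ∣ m →
    ∃ d, d ∣ m ∧ (∀ q, q.Prime → q ∣ d → q < p) ∧ p ≤ t * d

theorem isRough_one (y : ℕ) : IsRough y 1 :=
  ⟨one_ne_zero, fun _ hp h ↦ absurd (Nat.dvd_one.1 h) hp.ne_one⟩

theorem IsRough.mul {y a b : ℕ} (ha : IsRough y a) (hb : IsRough y b) : IsRough y (a * b) :=
  ⟨mul_ne_zero ha.1 hb.1, fun p hp h ↦ (hp.dvd_mul.1 h).elim (ha.2 p hp) (hb.2 p hp)⟩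

theorem IsRough.of_dvd {y a b : ℕ} (hb : IsRough y b) (h : a ∣ b) : IsRough y a :=
  ⟨ne_zero_of_dvd_ne_zero hb.1 h, fun p hp hpa ↦ hb.2 p hp (hpa.trans h)⟩

theorem IsRough.mono {y z a : ℕ} (h : IsRough z a) (hyz : y ≤ z) : IsRough y a :=
  ⟨h.1, fun p hp hpa ↦ hyz.trans_lt (h.2 p hp hpa)⟩

theorem isGapDense_one (t : ℕ) : IsGapDense t 1 :=
  ⟨isRough_one 2, fun _ hp h ↦ absurd (Nat.dvd_one.1 h) hp.ne_one⟩

theorem IsGapDense.pos {t m : ℕ} (h : IsGapDense t m) : 0 < m := Nat.pos_of_ne_zero h.1.1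

theorem IsGapDense.mul_prime {t m p : ℕ} (hm : IsGapDense t m) (hp : p.Prime) (h2 : 2 < p)
    (hpm : p ≤ t * m) : IsGapDense t (m * p) := by
  refine ⟨hm.1.mul ⟨hp.ne_zero, fun q hq h ↦ ?_⟩, fun q hq hqd ↦ ?_⟩
  · rwa [(Nat.prime_dvd_prime_iff_eq hq hp).1 h]
  by_cases hqm : q ∣ m
  · obtain ⟨d, hd, h⟩ := hm.2 q hq hqm
    exact ⟨d, hd.mul_right p, h⟩
  obtain rfl : q = p := (Nat.prime_dvd_prime_iff_eq hq hp).1 ((hq.dvd_mul.1 hqd).resolve_left hqm)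
  by_cases hbig : ∃ r, r.Prime ∧ r ∣ m ∧ q < r
  · classical
    obtain ⟨hr, hrm, hqr⟩ := Nat.find_spec hbig
    have hmin := fun k ↦ Nat.find_min hbig (m := k)
    set r := Nat.find hbig
    obtain ⟨d, hd, hdr, hrd⟩ := hm.2 r hr hrm
    refine ⟨d, hd.mul_right q, fun k hk hkd ↦ ?_, hqr.le.trans hrd⟩
    have h1 := hdr k hk hkd
    rcases lt_trichotomy k q with h | h | h
    · exact h
    · exact absurd (h ▸ hkd.trans hd) hqm
    · exact absurd ⟨hk, hkd.trans hd, h⟩ (hmin k h1)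
  · push Not at hbig
    refine ⟨m, dvd_mul_right m q, fun k hk hkm ↦ lt_of_le_of_ne (hbig k hk hkm) ?_, hpm⟩
    rintro rfl
    exact hqm hkm

theorem IsGapDense.prime_le {t m p : ℕ} (hm : IsGapDense t m) (hp : p.Prime) (h : p ∣ m) :
    p ≤ t * m := by
  obtain ⟨d, hd, -, h⟩ := hm.2 p hp h
  exact h.trans (Nat.mul_le_mul_left t (Nat.le_of_dvd hm.pos hd))

theorem exists_isGapDense_mul_isRough {n : ℕ} (t : ℕ) (hn : IsRough 2 n) :
    ∃ m r, IsGapDense t m ∧ IsRough (t * m) r ∧ m * r = n := by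
  classical
  let S := {d ∈ n.divisors | IsGapDense t d}
  have hS : S.Nonempty := ⟨1, by simp [S, hn.1, isGapDense_one]⟩
  obtain ⟨m, hmS, hmax⟩ := S.exists_max_image id hS
  simp only [S, Finset.mem_filter, Nat.mem_divisors] at hmS hmax
  obtain ⟨⟨⟨r, rfl⟩, hn0⟩, hm⟩ := hmS
  refine ⟨m, r, hm, ⟨right_ne_zero_of_mul hn0, fun p hp hpr ↦ ?_⟩, rfl⟩
  by_contra! hle
  have h2 := hn.2 p hp (hpr.mul_left m)
  have := hmax (m * p) ⟨⟨mul_dvd_mul_left m hpr, hn0⟩, hm.mul_prime hp h2 hle⟩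
  simp only [id_eq] at this
  nlinarith [hm.pos, hp.two_le]

theorem coprime_of_isRough {a r y : ℕ} (hr : IsRough y r)
    (ha : ∀ p, p.Prime → p ∣ a → p ≤ y) : a.Coprime r :=
  Nat.Coprime.symm <| Nat.coprime_of_dvd fun p hp hpr hpa ↦
    absurd (ha p hp hpa) (hr.2 p hp hpr).not_ge

theorem IsGapDense.eq_of_mul_eq_of_le {t m m' r r' : ℕ} (hm : IsGapDense t m)
    (hm' : IsGapDense t m') (hr : IsRough (t * m) r) (hr' : IsRough (t * m') r')
    (h : m * r = m' * r') (hle : m ≤ m') : m = m' := by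
  have hco : m.Coprime r' := coprime_of_isRough hr' fun p hp hpm ↦
    (hm.prime_le hp hpm).trans (Nat.mul_le_mul_left t hle)
  obtain ⟨k, rfl⟩ : m ∣ m' := hco.dvd_of_dvd_mul_right (h ▸ dvd_mul_right m r)
  have hrk : r = k * r' := by
    rw [mul_assoc] at h
    exact Nat.eq_of_mul_eq_mul_left hm.pos h
  by_contra hne
  have hk : k ≠ 1 := by rintro rfl; simp at hne
  have hkr : IsRough (t * m) k := hr.of_dvd (hrk ▸ dvd_mul_right k r')
  have hp := Nat.minFac_prime hk
  obtain ⟨d, hd, hdp, hpd⟩ := hm'.2 _ hp ((Nat.minFac_dvd k).mul_left m)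
  have hdk : d.Coprime k := Nat.coprime_of_dvd fun q hq hqd hqk ↦
    absurd (Nat.minFac_le_of_dvd hq.two_le hqk) (hdp q hq hqd).not_ge
  have hdm : d ≤ m := Nat.le_of_dvd hm.pos (hdk.dvd_of_dvd_mul_right hd)
  exact absurd (hpd.trans (Nat.mul_le_mul_left t hdm)) (hkr.2 _ hp (Nat.minFac_dvd k)).not_ge

theorem bijective_isGapDense_mul_isRough {t : ℕ} (ht : 2 ≤ t) :
    Function.Bijective (fun x : Σ m : {m // IsGapDense t m}, {r // IsRough (t * m) r} ↦
      (⟨x.1 * x.2, x.1.2.1.mul (x.2.2.mono (by nlinarith [x.1.2.pos]))⟩ : {n // IsRough 2 n})) := by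
  constructor
  · rintro ⟨⟨m, hm⟩, ⟨r, hr⟩⟩ ⟨⟨m', hm'⟩, ⟨r', hr'⟩⟩ h
    simp only [Subtype.mk.injEq] at h
    obtain rfl : m = m' := by
      rcases le_total m m' with hle | hle
      · exact hm.eq_of_mul_eq_of_le hm' hr hr' h hle
      · exact (hm'.eq_of_mul_eq_of_le hm hr' hr h.symm hle).symm
    obtain rfl : r = r' := Nat.eq_of_mul_eq_mul_left hm.pos h
    rfl
  · rintro ⟨n, hn⟩
    obtain ⟨m, r, hm, hr, h⟩ := exists_isGapDense_mul_isRough t hn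
    exact ⟨⟨⟨m, hm⟩, ⟨r, hr⟩⟩, by simpa using h⟩


/-- The sum of `f` over the integers free of prime factors up to `y`. -/
noncomputable def roughSum (f : ℕ → ℝ≥0∞) (y : ℕ) : ℝ≥0∞ := ∑' r : {r // IsRough y r}, f r

/-- The sum of `Λ f` over the integers free of prime factors up to `y`. -/
noncomputable def roughLogSum (f : ℕ → ℝ≥0∞) (y : ℕ) : ℝ≥0∞ :=
  roughSum (fun d ↦ ENNReal.ofReal (ArithmeticFunction.vonMangoldt d) * f d) y

theorem tsum_isRough_two {t : ℕ} (ht : 2 ≤ t) (g : ℕ → ℝ≥0∞) :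
    ∑' n : {n // IsRough 2 n}, g n =
      ∑' m : {m // IsGapDense t m}, ∑' r : {r // IsRough (t * m) r}, g (m * r) := by
  rw [← ENNReal.tsum_sigma (fun (m : {m // IsGapDense t m}) (r : {r // IsRough (t * m) r}) ↦
      g (m * r)), ← (Equiv.ofBijective _ (bijective_isGapDense_mul_isRough ht)).tsum_eq]
  rfl

theorem tsum_gapDense_mul_roughSum {t : ℕ} (ht : 2 ≤ t) {f : ℕ → ℝ≥0∞}
    (hf : ∀ a b, f (a * b) = f a * f b) :
    ∑' m : {m // IsGapDense t m}, f m * roughSum f (t * m) = roughSum f 2 := by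
  rw [roughSum, tsum_isRough_two ht]
  simp_rw [hf, roughSum, ENNReal.tsum_mul_left]

theorem tsum_isRough_mul_log {f : ℕ → ℝ≥0∞} (hf : ∀ a b, f (a * b) = f a * f b) (y : ℕ) :
    roughSum (fun n ↦ f n * ENNReal.ofReal (Real.log n)) y =
      roughSum f y * roughLogSum f y := by
  let e : {d // IsRough y d} × {d // IsRough y d} →
      Σ n : {n // IsRough y n}, n.1.divisorsAntidiagonal := fun x ↦
    ⟨⟨x.1 * x.2, x.1.2.mul x.2.2⟩, ⟨(x.1, x.2), by
      simp [x.1.2.1, x.2.2.1]⟩⟩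
  have he : Function.Bijective e := by
    constructor
    · rintro ⟨⟨a, ha⟩, ⟨b, hb⟩⟩ ⟨⟨c, hc⟩, ⟨d, hd⟩⟩ h
      simp only [e, Sigma.mk.injEq, Subtype.mk.injEq] at h
      obtain ⟨h1, h2⟩ := h
      have h3 := (Subtype.heq_iff_coe_eq (by simp [h1])).1 h2
      simp only [Prod.mk.injEq] at h3
      simp [h3]
    · rintro ⟨⟨n, hn⟩, ⟨⟨a, b⟩, hab⟩⟩
      obtain ⟨rfl, -⟩ := Nat.mem_divisorsAntidiagonal.1 hab
      exact ⟨(⟨a, hn.of_dvd (dvd_mul_right a b)⟩, ⟨b, hn.of_dvd (dvd_mul_left b a)⟩), rfl⟩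
  symm
  calc roughSum f y * roughLogSum f y
      = ∑' x : {d // IsRough y d} × {d // IsRough y d},
          ENNReal.ofReal (ArithmeticFunction.vonMangoldt x.1) * f (x.1 * x.2) := by
        rw [ENNReal.tsum_prod (f := fun d r : {d // IsRough y d} ↦
          ENNReal.ofReal (ArithmeticFunction.vonMangoldt d) * f (d * r)), roughLogSum, mul_comm,
        roughSum, ← ENNReal.tsum_mul_right]
        refine tsum_congr fun d ↦ ?_
        rw [roughSum, ← ENNReal.tsum_mul_left]
        refine tsum_congr fun r ↦ ?_
        rw [hf, mul_assoc]
    _ = ∑' n : {n // IsRough y n}, ∑' x : n.1.divisorsAntidiagonal,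
          ENNReal.ofReal (ArithmeticFunction.vonMangoldt x.1.1) * f n := by
        rw [← ENNReal.tsum_sigma (fun (n : {n // IsRough y n}) (x : n.1.divisorsAntidiagonal) ↦
          ENNReal.ofReal (ArithmeticFunction.vonMangoldt x.1.1) * f n),
          ← (Equiv.ofBijective e he).tsum_eq]
        rfl
    _ = _ := by
        rw [roughSum]
        refine tsum_congr fun n ↦ ?_
        rw [ENNReal.tsum_mul_right, mul_comm, Finset.tsum_subtype n.1.divisorsAntidiagonal
          (fun x ↦ ENNReal.ofReal (ArithmeticFunction.vonMangoldt x.1)),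
          Nat.sum_divisorsAntidiagonal (fun d _ ↦ ENNReal.ofReal (ArithmeticFunction.vonMangoldt d)),
          ← ENNReal.ofReal_sum_of_nonneg fun _ _ ↦ ArithmeticFunction.vonMangoldt_nonneg,
          ArithmeticFunction.vonMangoldt_sum]

theorem one_div_mul_rpow_le {L : ℝ} (hL : 0 < L) {n : ℕ} (hn : 0 < n) :
    ((n + 1 : ℕ) : ℝ) ^ (-(1 + 1 / L)) ≤
      L * ((n : ℝ) ^ (-(1 / L)) - ((n + 1 : ℕ) : ℝ) ^ (-(1 / L))) := by
  have hn' : (0 : ℝ) < n := by exact_mod_cast hn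
  have hn1 : (0 : ℝ) < (n + 1 : ℕ) := by positivity
  have hbern : 1 + 1 / L * (1 / (n + 1 : ℕ)) ≤ (((n : ℝ) / (n + 1 : ℕ)) ^ (-(1 / L))) := by
    rw [Real.rpow_def_of_pos (by positivity)]
    have h1 := Real.add_one_le_exp (Real.log ((n : ℝ) / (n + 1 : ℕ)) * -(1 / L))
    have h2 := Real.log_le_sub_one_of_pos (x := (n : ℝ) / (n + 1 : ℕ)) (by positivity)
    have h3 : (n : ℝ) / (n + 1 : ℕ) - 1 = -(1 / (n + 1 : ℕ)) := by
      field_simp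
      push_cast
      ring
    rw [h3] at h2
    have h4 : 0 < 1 / L := by positivity
    nlinarith
  rw [Real.div_rpow hn'.le hn1.le, le_div_iff₀ (by positivity)] at hbern
  have h5 : ((n + 1 : ℕ) : ℝ) ^ (-(1 + 1 / L)) =
      ((n + 1 : ℕ) : ℝ) ^ (-(1 / L)) * (1 / (n + 1 : ℕ)) := by
    rw [show -(1 + 1 / L) = -(1 / L) + -1 by ring, Real.rpow_add hn1, Real.rpow_neg_one,
      one_div (((n + 1 : ℕ) : ℝ))]
  rw [h5]
  have h6 : L * (1 / L) = 1 := by field_simp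
  calc _ = L * (1 / L) * (((n + 1 : ℕ) : ℝ) ^ (-(1 / L)) * (1 / (n + 1 : ℕ))) := by
        rw [h6, one_mul]
    _ = L * ((1 + 1 / L * (1 / (n + 1 : ℕ))) * ((n + 1 : ℕ) : ℝ) ^ (-(1 / L)) -
          ((n + 1 : ℕ) : ℝ) ^ (-(1 / L))) := by ring
    _ ≤ _ := by gcongr

theorem sum_range_rpow_le {L : ℝ} (hL : 0 < L) (N : ℕ) :
    ∑ n ∈ Finset.range N, (n : ℝ) ^ (-(1 + 1 / L)) ≤ 1 + L := by
  have key (N : ℕ) : ∑ n ∈ Finset.range (N + 2), (n : ℝ) ^ (-(1 + 1 / L)) ≤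
      1 + L - L * ((N + 1 : ℕ) : ℝ) ^ (-(1 / L)) := by
    induction N with
    | zero =>
      have h : -(1 + 1 / L) ≠ 0 := by
        have : 0 < 1 / L := by positivity
        linarith
      simp only [Finset.sum_range_succ, Finset.range_zero, Finset.sum_empty, Nat.cast_zero,
        Nat.cast_one, Real.one_rpow, zero_add]
      rw [Real.zero_rpow h]
      linarith
    | succ k ih =>
      rw [Finset.sum_range_succ]
      have := one_div_mul_rpow_le hL (Nat.succ_pos k)
      push_cast at this ih ⊢
      rw [show (k : ℝ) + 2 = k + 1 + 1 by ring]
      linarith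
  calc _ ≤ ∑ n ∈ Finset.range (N + 2), (n : ℝ) ^ (-(1 + 1 / L)) :=
        Finset.sum_le_sum_of_subset_of_nonneg (Finset.range_mono (by omega))
          fun _ _ _ ↦ by positivity
    _ ≤ _ := key N
    _ ≤ _ := by
      have : 0 ≤ L * ((N + 1 : ℕ) : ℝ) ^ (-(1 / L)) := by positivity
      linarith

/-- The weight `n ^ (-1 - 1 / L)` in `ℝ≥0∞`. -/
noncomputable def weight (L : ℝ) (n : ℕ) : ℝ≥0∞ := ENNReal.ofReal ((n : ℝ) ^ (-(1 + 1 / L)))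

theorem weight_mul (L : ℝ) (a b : ℕ) : weight L (a * b) = weight L a * weight L b := by
  rw [weight, weight, weight, ← ENNReal.ofReal_mul (by positivity), Nat.cast_mul,
    Real.mul_rpow (by positivity) (by positivity)]

theorem weight_one (L : ℝ) : weight L 1 = 1 := by simp [weight]

theorem tsum_subtype_le_ofReal {P : ℕ → Prop} {g : ℕ → ℝ} {c : ℝ} (hg : ∀ n, 0 ≤ g n)
    (h : ∀ S : Finset ℕ, (∀ n ∈ S, P n) → ∑ n ∈ S, g n ≤ c) :
    ∑' n : {n // P n}, ENNReal.ofReal (g n) ≤ ENNReal.ofReal c := by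
  rw [ENNReal.tsum_eq_iSup_sum]
  refine iSup_le fun S ↦ ?_
  rw [← ENNReal.ofReal_sum_of_nonneg (f := fun n : {n // P n} ↦ g n) fun n _ ↦ hg n]
  refine ENNReal.ofReal_le_ofReal ?_
  have := h (S.map (Function.Embedding.subtype P)) (by
    intro n hn
    obtain ⟨m, -, rfl⟩ := Finset.mem_map.1 hn
    exact m.2)
  simpa [Finset.sum_map] using this

theorem ofReal_sum_le_tsum_subtype {P : ℕ → Prop} {g : ℕ → ℝ} (hg : ∀ n, 0 ≤ g n)
    {S : Finset ℕ} (hS : ∀ n ∈ S, P n) :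
    ENNReal.ofReal (∑ n ∈ S, g n) ≤ ∑' n : {n // P n}, ENNReal.ofReal (g n) := by
  classical
  rw [ENNReal.ofReal_sum_of_nonneg fun n _ ↦ hg n]
  refine le_trans (le_of_eq ?_) (ENNReal.sum_le_tsum (S.subtype P))
  rw [Finset.sum_subtype_eq_sum_filter (f := fun n ↦ ENNReal.ofReal (g n)),
    Finset.filter_true_of_mem hS]

theorem sum_rpow_le {L : ℝ} (hL : 0 < L) (S : Finset ℕ) :
    ∑ n ∈ S, (n : ℝ) ^ (-(1 + 1 / L)) ≤ 1 + L := by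
  obtain ⟨N, hN⟩ := S.exists_nat_subset_range
  exact (Finset.sum_le_sum_of_subset_of_nonneg hN fun _ _ _ ↦ by positivity).trans
    (sum_range_rpow_le hL N)

theorem roughSum_weight_le {L : ℝ} (hL : 0 < L) (y : ℕ) :
    roughSum (weight L) y ≤ ENNReal.ofReal (1 + L) :=
  tsum_subtype_le_ofReal (fun _ ↦ by positivity) fun S _ ↦ sum_rpow_le hL S

theorem roughSum_weight_mul_log_le {L : ℝ} (hL : 0 < L) (y : ℕ) :
    roughSum (fun n ↦ weight L n * ENNReal.ofReal (Real.log n)) y ≤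
      ENNReal.ofReal (2 * L * (1 + 2 * L)) := by
  have h : ∀ n : ℕ, (n : ℝ) ^ (-(1 + 1 / L)) * Real.log n ≤
      2 * L * (n : ℝ) ^ (-(1 + 1 / (2 * L))) := by
    intro n
    rcases Nat.eq_zero_or_pos n with rfl | hn
    · simp only [Nat.cast_zero, Real.log_zero, mul_zero]
      positivity
    have hn' : (0 : ℝ) < n := by exact_mod_cast hn
    have h1 := Real.log_natCast_le_rpow_div n (ε := 1 / (2 * L)) (by positivity)
    have h2 : (n : ℝ) ^ (-(1 + 1 / (2 * L))) =
        (n : ℝ) ^ (-(1 + 1 / L)) * (n : ℝ) ^ (1 / (2 * L)) := by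
      rw [← Real.rpow_add hn']
      congr 1
      field_simp
      ring
    rw [h2]
    have h3 : (n : ℝ) ^ (1 / (2 * L)) / (1 / (2 * L)) = 2 * L * (n : ℝ) ^ (1 / (2 * L)) := by
      field_simp
    rw [h3] at h1
    calc _ ≤ (n : ℝ) ^ (-(1 + 1 / L)) * (2 * L * (n : ℝ) ^ (1 / (2 * L))) := by gcongr
      _ = _ := by ring
  have h' : ∀ n : ℕ, weight L n * ENNReal.ofReal (Real.log n) =
      ENNReal.ofReal ((n : ℝ) ^ (-(1 + 1 / L)) * Real.log n) := fun n ↦ by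
    rw [weight, ENNReal.ofReal_mul (by positivity)]
  simp_rw [h', roughSum]
  refine tsum_subtype_le_ofReal (fun n ↦ mul_nonneg (by positivity) (Real.log_natCast_nonneg n))
    fun S _ ↦ (Finset.sum_le_sum fun n _ ↦ h n).trans ?_
  rw [← Finset.mul_sum]
  gcongr
  exact sum_rpow_le (by positivity) S

open Finset in
theorem log_le_two_mul_sum_odd {z : ℝ} (hz : 1 ≤ z) :
    Real.log z ≤ 2 * ∑ n ∈ Ioc 0 ⌊z⌋₊ with Odd n, (1 : ℝ) / n := by
  have h1 : Real.log z ≤ ∑ n ∈ Ioc 0 ⌊z⌋₊, (1 : ℝ) / n := by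
    have h := log_add_one_le_harmonic ⌊z⌋₊
    rw [harmonic_eq_sum_Icc] at h
    push_cast at h
    calc Real.log z ≤ Real.log (⌊z⌋₊ + 1) :=
          Real.log_le_log (by linarith) (Nat.lt_floor_add_one z).le
      _ ≤ _ := h
      _ = _ := by simp only [one_div]; rfl
  rw [← sum_filter_add_sum_filter_not (Ioc 0 ⌊z⌋₊) Odd] at h1
  have h2 : ∑ n ∈ Ioc 0 ⌊z⌋₊ with ¬ Odd n, (1 : ℝ) / n ≤
      ∑ n ∈ Ioc 0 ⌊z⌋₊ with Odd n, (1 : ℝ) / n := by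
    have hinj : Set.InjOn (fun n : ℕ ↦ n - 1) (({n ∈ Ioc 0 ⌊z⌋₊ | ¬ Odd n} : Finset ℕ) : Set ℕ) := by
      intro a ha b hb h
      simp only [coe_filter, mem_Ioc, Set.mem_ofPred_eq] at ha hb h
      omega
    calc _ ≤ ∑ n ∈ Ioc 0 ⌊z⌋₊ with ¬ Odd n, (1 : ℝ) / ((n - 1 : ℕ) : ℝ) := by
          refine sum_le_sum fun n hn ↦ ?_
          simp only [mem_filter, mem_Ioc, Nat.not_odd_iff_even] at hn
          obtain ⟨k, rfl⟩ := hn.2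
          have : 0 < k + k - 1 := by omega
          gcongr
          omega
      _ = ∑ n ∈ image (fun n : ℕ ↦ n - 1) {n ∈ Ioc 0 ⌊z⌋₊ | ¬ Odd n}, (1 : ℝ) / (n : ℝ) :=
          (sum_image (f := fun n : ℕ ↦ (1 : ℝ) / n) hinj).symm
      _ ≤ _ := by
          refine sum_le_sum_of_subset_of_nonneg ?_ fun _ _ _ ↦ by positivity
          intro m hm
          obtain ⟨n, hn, rfl⟩ := mem_image.1 hm
          simp only [mem_filter, mem_Ioc, Nat.not_odd_iff_even] at hn ⊢
          obtain ⟨k, rfl⟩ := hn.2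
          exact ⟨by omega, ⟨k - 1, by omega⟩⟩
  linarith

open Finset in
theorem min_log_le_sum_odd_rpow {L : ℝ} (hL : 0 < L) {y : ℕ} (hy : 1 ≤ y) :
    min (Real.log y) L ≤ 6 * ∑ n ∈ Ioc 0 y with Odd n, (n : ℝ) ^ (-(1 + 1 / L)) := by
  set z := min (y : ℝ) (Real.exp L) with hzdef
  have hy' : (1 : ℝ) ≤ y := by exact_mod_cast hy
  have hz : 1 ≤ z := le_min hy' (Real.one_le_exp hL.le)
  have hlog : min (Real.log y) L = Real.log z := by
    rcases le_total (y : ℝ) (Real.exp L) with h | h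
    · rw [hzdef, min_eq_left h, min_eq_left]
      exact (Real.log_le_iff_le_exp (by linarith)).2 h
    · rw [hzdef, min_eq_right h, Real.log_exp, min_eq_right]
      exact (Real.le_log_iff_exp_le (by linarith)).2 h
  have hsub : {n ∈ Ioc 0 ⌊z⌋₊ | Odd n} ⊆ {n ∈ Ioc 0 y | Odd n} := by
    refine filter_subset_filter _ (Ioc_subset_Ioc_right ?_)
    exact Nat.floor_le_of_le (min_le_left _ _)
  have hle : ∀ n ∈ {n ∈ Ioc 0 ⌊z⌋₊ | Odd n}, (1 : ℝ) / n ≤ 3 * (n : ℝ) ^ (-(1 + 1 / L)) := by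
    intro n hn
    simp only [mem_filter, mem_Ioc] at hn
    have hn' : (0 : ℝ) < n := by exact_mod_cast hn.1.1
    have hnz : (n : ℝ) ≤ Real.exp L :=
      (Nat.le_floor_iff (by linarith)).1 hn.1.2 |>.trans (min_le_right _ _)
    have h1 : (n : ℝ) ^ (1 / L) ≤ 3 := by
      calc (n : ℝ) ^ (1 / L) ≤ (Real.exp L) ^ (1 / L) := by gcongr
        _ = Real.exp 1 := by rw [← Real.exp_mul]; congr 1; field_simp
        _ ≤ 3 := by linarith [Real.exp_one_lt_d9]
    rw [neg_add, Real.rpow_add hn', Real.rpow_neg_one, Real.rpow_neg hn'.le (1 / L), ← mul_assoc,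
      ← div_eq_mul_inv _ ((n : ℝ) ^ (1 / L)), le_div_iff₀ (by positivity)]
    rw [one_div, mul_comm]
    gcongr
  calc _ = Real.log z := hlog
    _ ≤ 2 * ∑ n ∈ Ioc 0 ⌊z⌋₊ with Odd n, (1 : ℝ) / n := log_le_two_mul_sum_odd hz
    _ ≤ 2 * ∑ n ∈ Ioc 0 ⌊z⌋₊ with Odd n, 3 * (n : ℝ) ^ (-(1 + 1 / L)) := by
        gcongr with n hn
        exact hle n hn
    _ = 6 * ∑ n ∈ Ioc 0 ⌊z⌋₊ with Odd n, (n : ℝ) ^ (-(1 + 1 / L)) := by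
        rw [← mul_sum]; ring
    _ ≤ _ := by
        gcongr

/-- The sum of `Λ f` over the odd integers that have a prime factor up to `y`. -/
noncomputable def lowLogSum (f : ℕ → ℝ≥0∞) (y : ℕ) : ℝ≥0∞ :=
  ∑' d : {d // IsRough 2 d ∧ ¬ IsRough y d}, ENNReal.ofReal (ArithmeticFunction.vonMangoldt d) * f d

theorem lowLogSum_add_roughLogSum (f : ℕ → ℝ≥0∞) {y : ℕ} (hy : 2 ≤ y) :
    lowLogSum f y + roughLogSum f y = roughLogSum f 2 := by
  have h (P : ℕ → Prop) (g : ℕ → ℝ≥0∞) : ∑' d : {d // P d}, g d = ∑' d, {d | P d}.indicator g d :=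
    tsum_subtype {d | P d} g
  rw [lowLogSum, roughLogSum, roughLogSum, roughSum, roughSum,
    h _ (fun d ↦ ENNReal.ofReal (ArithmeticFunction.vonMangoldt d) * f d),
    h _ (fun d ↦ ENNReal.ofReal (ArithmeticFunction.vonMangoldt d) * f d),
    h _ (fun d ↦ ENNReal.ofReal (ArithmeticFunction.vonMangoldt d) * f d), ← ENNReal.tsum_add]
  refine tsum_congr fun d ↦ ?_
  by_cases h1 : IsRough y d
  · simp [h1, h1.mono hy]
  · by_cases h2 : IsRough 2 d <;> simp [h1, h2]

theorem one_le_roughSum_weight (L : ℝ) (y : ℕ) : 1 ≤ roughSum (weight L) y :=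
  calc 1 = weight L 1 := (weight_one L).symm
    _ ≤ roughSum (weight L) y :=
      ENNReal.le_tsum (f := fun r : {r // IsRough y r} ↦ weight L r) ⟨1, isRough_one y⟩

theorem isRough_two_of_odd {n : ℕ} (h : Odd n) : IsRough 2 n := by
  refine ⟨h.pos.ne', fun p hp hpn ↦ lt_of_le_of_ne hp.two_le ?_⟩
  rintro rfl
  exact (Nat.not_even_iff_odd.2 h) (even_iff_two_dvd.2 hpn)

open Finset in
theorem ofReal_min_log_le_roughSum_weight {L : ℝ} (hL : 0 < L) {y : ℕ} (hy : 1 ≤ y) :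
    ENNReal.ofReal (min (Real.log y) L) ≤ 6 * roughSum (weight L) 2 := by
  calc _ ≤ ENNReal.ofReal (6 * ∑ n ∈ Ioc 0 y with Odd n, (n : ℝ) ^ (-(1 + 1 / L))) :=
        ENNReal.ofReal_le_ofReal (min_log_le_sum_odd_rpow hL hy)
    _ = 6 * ENNReal.ofReal (∑ n ∈ Ioc 0 y with Odd n, (n : ℝ) ^ (-(1 + 1 / L))) := by
        rw [ENNReal.ofReal_mul (by norm_num)]; norm_num
    _ ≤ _ := by
        gcongr
        exact ofReal_sum_le_tsum_subtype (fun n ↦ by positivity) fun n hn ↦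
          isRough_two_of_odd (mem_filter.1 hn).2

open Finset in
theorem roughSum_weight_mul_min_log_le {L : ℝ} (hL : 0 < L) {y : ℕ} (hy : 2 ≤ y) :
    roughSum (weight L) y * ENNReal.ofReal (min (Real.log y) L) ≤ 6 * roughSum (weight L) 2 := by
  have key : roughSum (weight L) y *
      ENNReal.ofReal (∑ n ∈ Ioc 0 y with Odd n, (n : ℝ) ^ (-(1 + 1 / L))) ≤
      roughSum (weight L) 2 := by
    have h1 : ENNReal.ofReal (∑ n ∈ Ioc 0 y with Odd n, (n : ℝ) ^ (-(1 + 1 / L))) ≤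
        ∑' n : {n // Odd n ∧ n ≤ y}, weight L n :=
      ofReal_sum_le_tsum_subtype (fun n ↦ by positivity) fun n hn ↦ by
        simp only [mem_filter, mem_Ioc] at hn
        exact ⟨hn.2, hn.1.2⟩
    let e : {n // Odd n ∧ n ≤ y} × {r // IsRough y r} → {n // IsRough 2 n} := fun x ↦
      ⟨x.1 * x.2, (isRough_two_of_odd x.1.2.1).mul (x.2.2.mono hy)⟩
    have he : Function.Injective e := by
      rintro ⟨⟨a, ha, hay⟩, ⟨r, hr⟩⟩ ⟨⟨b, hb, hby⟩, ⟨s, hs⟩⟩ h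
      simp only [e, Subtype.mk.injEq] at h
      have hco {a r : ℕ} (ha : Odd a) (hay : a ≤ y) (hr : IsRough y r) : a.Coprime r :=
        coprime_of_isRough hr fun p _ hpa ↦ (Nat.le_of_dvd ha.pos hpa).trans hay
      obtain rfl : a = b := Nat.dvd_antisymm
        ((hco ha hay hs).dvd_of_dvd_mul_right (h ▸ dvd_mul_right a r))
        ((hco hb hby hr).dvd_of_dvd_mul_right (h ▸ dvd_mul_right b s))
      obtain rfl : r = s := Nat.eq_of_mul_eq_mul_left ha.pos h
      rfl
    calc _ ≤ roughSum (weight L) y * ∑' n : {n // Odd n ∧ n ≤ y}, weight L n := by gcongr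
      _ = ∑' x : {n // Odd n ∧ n ≤ y} × {r // IsRough y r}, weight L (x.1 * x.2) := by
        rw [ENNReal.tsum_prod (f := fun (n : {n // Odd n ∧ n ≤ y}) (r : {r // IsRough y r}) ↦
          weight L (n * r)), mul_comm, ← ENNReal.tsum_mul_right]
        refine tsum_congr fun n ↦ ?_
        rw [roughSum, ← ENNReal.tsum_mul_left]
        simp_rw [weight_mul]
      _ ≤ _ := ENNReal.tsum_comp_le_tsum_of_injective he (fun n : {n // IsRough 2 n} ↦ weight L n)
  calc _ ≤ roughSum (weight L) y *
        ENNReal.ofReal (6 * ∑ n ∈ Ioc 0 y with Odd n, (n : ℝ) ^ (-(1 + 1 / L))) := by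
        gcongr
        exact min_log_le_sum_odd_rpow hL (by omega)
    _ = 6 * (roughSum (weight L) y *
        ENNReal.ofReal (∑ n ∈ Ioc 0 y with Odd n, (n : ℝ) ^ (-(1 + 1 / L)))) := by
        rw [ENNReal.ofReal_mul (by norm_num), mul_left_comm]; norm_num
    _ ≤ _ := by gcongr

theorem roughLogSum_weight_two_le {L : ℝ} (hL : 1 ≤ L) :
    roughLogSum (weight L) 2 ≤ ENNReal.ofReal (36 * L) := by
  have h1 : ENNReal.ofReal L ≤ 6 * roughSum (weight L) 2 := by
    have hle : Real.exp L ≤ ⌈Real.exp L⌉₊ := Nat.le_ceil _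
    have hpos : 1 ≤ ⌈Real.exp L⌉₊ := Nat.ceil_pos.2 (Real.exp_pos L)
    refine le_trans (ENNReal.ofReal_le_ofReal ?_)
      (ofReal_min_log_le_roughSum_weight (by linarith) hpos)
    rw [le_min_iff]
    refine ⟨?_, le_rfl⟩
    rw [Real.le_log_iff_exp_le (by exact_mod_cast hpos)]
    exact hle
  have h2 := roughSum_weight_mul_log_le (L := L) (by linarith) 2
  rw [tsum_isRough_mul_log (weight_mul L)] at h2
  have h3 : ENNReal.ofReal L * roughLogSum (weight L) 2 ≤
      ENNReal.ofReal L * ENNReal.ofReal (36 * L) :=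
    calc _ ≤ 6 * roughSum (weight L) 2 * roughLogSum (weight L) 2 := by gcongr
      _ = 6 * (roughSum (weight L) 2 * roughLogSum (weight L) 2) := mul_assoc _ _ _
      _ ≤ ENNReal.ofReal 6 * ENNReal.ofReal (2 * L * (1 + 2 * L)) := by
        gcongr
        norm_num
      _ = ENNReal.ofReal (6 * (2 * L * (1 + 2 * L))) := (ENNReal.ofReal_mul (by norm_num)).symm
      _ ≤ ENNReal.ofReal (L * (36 * L)) := ENNReal.ofReal_le_ofReal (by nlinarith)
      _ = _ := ENNReal.ofReal_mul (by linarith)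
  exact (ENNReal.mul_le_mul_iff_right (by simpa using by linarith) ENNReal.ofReal_ne_top).1 h3

theorem tsum_gapDense_mul_log_eq {L : ℝ} (hL : 0 < L) {t : ℕ} (ht : 2 ≤ t) :
    ∑' m : {m // IsGapDense t m}, weight L m * roughSum (weight L) (t * m) *
        ENNReal.ofReal (Real.log m) =
      ∑' m : {m // IsGapDense t m}, weight L m * roughSum (weight L) (t * m) *
        lowLogSum (weight L) (t * m) := by
  set Z := ∑' m : {m // IsGapDense t m}, weight L m * roughSum (weight L) (t * m) *
    roughLogSum (weight L) (t * m) with hZ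
  have h1 : roughSum (fun n ↦ weight L n * ENNReal.ofReal (Real.log n)) 2 =
      (∑' m : {m // IsGapDense t m}, weight L m * roughSum (weight L) (t * m) *
        ENNReal.ofReal (Real.log m)) + Z := by
    rw [roughSum, tsum_isRough_two ht (fun n ↦ weight L n * ENNReal.ofReal (Real.log n)), hZ, ← ENNReal.tsum_add]
    refine tsum_congr fun m ↦ ?_
    rw [mul_assoc, mul_assoc, ← tsum_isRough_mul_log (weight_mul L), roughSum, roughSum,
      ← mul_add, ← ENNReal.tsum_mul_right, ← ENNReal.tsum_add, ← ENNReal.tsum_mul_left]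
    refine tsum_congr fun r ↦ ?_
    have hm := m.2.pos
    have hr := Nat.pos_of_ne_zero r.2.1
    rw [weight_mul, Nat.cast_mul, Real.log_mul (by positivity) (by positivity),
      ENNReal.ofReal_add (Real.log_natCast_nonneg _) (Real.log_natCast_nonneg _)]
    ring
  have h2 : roughSum (fun n ↦ weight L n * ENNReal.ofReal (Real.log n)) 2 =
      (∑' m : {m // IsGapDense t m}, weight L m * roughSum (weight L) (t * m) *
        lowLogSum (weight L) (t * m)) + Z := by
    rw [tsum_isRough_mul_log (weight_mul L), ← tsum_gapDense_mul_roughSum ht (weight_mul L), hZ,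
      ← ENNReal.tsum_add, ← ENNReal.tsum_mul_right]
    refine tsum_congr fun m ↦ ?_
    rw [← mul_add, lowLogSum_add_roughLogSum _ (by nlinarith [m.2.pos])]
  have hfin : roughSum (fun n ↦ weight L n * ENNReal.ofReal (Real.log n)) 2 ≠ ⊤ :=
    ((roughSum_weight_mul_log_le hL 2).trans_lt ENNReal.ofReal_lt_top).ne
  have hZf : Z ≠ ⊤ := by
    intro h
    rw [h, add_top] at h1
    exact hfin h1
  exact (ENNReal.add_left_inj hZf).1 (h1.symm.trans h2)

theorem tsum_gapDense_mul_log_ne_top {L : ℝ} (hL : 0 < L) {t : ℕ} (ht : 2 ≤ t) :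
    ∑' m : {m // IsGapDense t m}, weight L m * roughSum (weight L) (t * m) *
        lowLogSum (weight L) (t * m) ≠ ⊤ := by
  have h := roughSum_weight_mul_log_le hL 2
  rw [tsum_isRough_mul_log (weight_mul L), ← tsum_gapDense_mul_roughSum ht (weight_mul L),
    ← ENNReal.tsum_mul_right] at h
  refine ((ENNReal.tsum_le_tsum fun m ↦ ?_).trans_lt (h.trans_lt ENNReal.ofReal_lt_top)).ne
  gcongr
  rw [← lowLogSum_add_roughLogSum (weight L) (y := t * m) (by nlinarith [m.2.pos])]
  exact le_self_add

theorem vonMangoldt_mul_rpow_le {L : ℝ} (hL : 0 < L) (d : ℕ) :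
    ArithmeticFunction.vonMangoldt d * (d : ℝ) ^ (-(1 + 1 / L)) ≤
      ArithmeticFunction.vonMangoldt d / d := by
  rcases Nat.eq_zero_or_pos d with rfl | hd
  · simp
  rw [div_eq_mul_inv _ (d : ℝ), ← Real.rpow_neg_one (d : ℝ)]
  refine mul_le_mul_of_nonneg_left ?_ ArithmeticFunction.vonMangoldt_nonneg
  refine Real.rpow_le_rpow_of_exponent_le (Nat.one_le_cast.2 hd) ?_
  have : 0 < 1 / L := by positivity
  linarith

open Finset in
theorem exists_lowLogSum_weight_le : ∃ C : ℝ, 0 ≤ C ∧ ∀ L : ℝ, 0 < L → ∀ y : ℕ, 1 ≤ y →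
    lowLogSum (weight L) y ≤ ENNReal.ofReal (Real.log y + C) := by
  obtain ⟨C, hC, h⟩ := exists_sum_vonMangoldt_div_not_prime_le
  refine ⟨C + 6, by linarith, fun L hL y hy ↦ ?_⟩
  have hw : ∀ d : ℕ, ENNReal.ofReal (ArithmeticFunction.vonMangoldt d) * weight L d =
      ENNReal.ofReal (ArithmeticFunction.vonMangoldt d * (d : ℝ) ^ (-(1 + 1 / L))) := fun d ↦ by
    rw [weight, ENNReal.ofReal_mul ArithmeticFunction.vonMangoldt_nonneg]
  simp_rw [lowLogSum, hw]
  refine tsum_subtype_le_ofReal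
    (g := fun d ↦ ArithmeticFunction.vonMangoldt d * (d : ℝ) ^ (-(1 + 1 / L)))
    (fun d ↦ mul_nonneg ArithmeticFunction.vonMangoldt_nonneg (by positivity)) fun S hS ↦ ?_
  refine (sum_le_sum fun d _ ↦ vonMangoldt_mul_rpow_le hL d).trans ?_
  rw [← sum_filter_add_sum_filter_not S Nat.Prime]
  have h1 := h {d ∈ S | ¬ d.Prime} fun d hd ↦ (mem_filter.1 hd).2
  have h2 := sum_vonMangoldt_div_le (y := y) (by exact_mod_cast hy)
  have h3 : ∑ d ∈ S with d.Prime, ArithmeticFunction.vonMangoldt d / d ≤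
      ∑ d ∈ Ioc 0 ⌊(y : ℝ)⌋₊, ArithmeticFunction.vonMangoldt d / d := by
    refine sum_le_sum_of_subset_of_nonneg (fun p hp ↦ ?_) fun d _ _ ↦
      div_nonneg ArithmeticFunction.vonMangoldt_nonneg (by positivity)
    obtain ⟨hpS, hp⟩ := mem_filter.1 hp
    rw [Nat.floor_natCast, mem_Ioc]
    refine ⟨hp.pos, ?_⟩
    by_contra! hlt
    refine (hS p hpS).2 ⟨hp.ne_zero, fun q hq hqp ↦ ?_⟩
    rwa [(Nat.prime_dvd_prime_iff_eq hq hp).1 hqp]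
  linarith

open Finset in
theorem exists_le_lowLogSum_weight : ∃ C : ℝ, 0 ≤ C ∧ ∀ L : ℝ, 0 < L → ∀ y : ℕ, 1 ≤ y →
    ENNReal.ofReal (Real.log y - C - (Real.log y + 6) * Real.log y / L) ≤
      lowLogSum (weight L) y := by
  obtain ⟨C, hC, h⟩ := exists_le_sum_log_prime_div
  refine ⟨C, hC, fun L hL y hy ↦ ?_⟩
  have hw : ∀ d : ℕ, ENNReal.ofReal (ArithmeticFunction.vonMangoldt d) * weight L d =
      ENNReal.ofReal (ArithmeticFunction.vonMangoldt d * (d : ℝ) ^ (-(1 + 1 / L))) := fun d ↦ by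
    rw [weight, ENNReal.ofReal_mul ArithmeticFunction.vonMangoldt_nonneg]
  simp_rw [lowLogSum, hw]
  refine le_trans (ENNReal.ofReal_le_ofReal ?_) (ofReal_sum_le_tsum_subtype
    (g := fun d ↦ ArithmeticFunction.vonMangoldt d * (d : ℝ) ^ (-(1 + 1 / L)))
    (S := {p ∈ Ioc 2 y | p.Prime}) (fun d ↦ mul_nonneg ArithmeticFunction.vonMangoldt_nonneg
      (by positivity)) fun p hp ↦ ?_)
  swap
  · simp only [mem_filter, mem_Ioc] at hp
    refine ⟨⟨hp.2.ne_zero, fun q hq hqp ↦ ?_⟩, fun hr ↦ ?_⟩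
    · rw [(Nat.prime_dvd_prime_iff_eq hq hp.2).1 hqp]
      exact hp.1.1
    · exact (hr.2 p hp.2 dvd_rfl).not_ge hp.1.2
  have h1 := h y (by exact_mod_cast hy)
  rw [Nat.floor_natCast] at h1
  have hterm : ∀ p ∈ {p ∈ Ioc 2 y | p.Prime}, Real.log p / p * (1 - Real.log y / L) ≤
      ArithmeticFunction.vonMangoldt p * (p : ℝ) ^ (-(1 + 1 / L)) := by
    intro p hp
    simp only [mem_filter, mem_Ioc] at hp
    have hp0 : (0 : ℝ) < p := by exact_mod_cast hp.2.pos
    have h2 : 1 - Real.log y / L ≤ (p : ℝ) ^ (-(1 / L)) := by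
      rw [Real.rpow_def_of_pos hp0]
      have h3 := Real.add_one_le_exp (Real.log p * -(1 / L))
      have h4 : Real.log p ≤ Real.log y := Real.log_le_log hp0 (by exact_mod_cast hp.1.2)
      have h5 : Real.log p / L ≤ Real.log y / L := by gcongr
      have h6 : Real.log p * -(1 / L) = -(Real.log p / L) := by ring
      linarith
    rw [ArithmeticFunction.vonMangoldt_apply_prime hp.2,
      show -(1 + 1 / L) = -1 + -(1 / L) by ring, Real.rpow_add hp0, Real.rpow_neg_one, ← mul_assoc,
      ← div_eq_mul_inv]
    gcongr
  refine le_trans ?_ (sum_le_sum hterm)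
  rw [← sum_mul]
  have h2 : ∑ p ∈ Ioc 2 y with p.Prime, Real.log p / p ≤ Real.log y + 6 := by
    have h3 := sum_vonMangoldt_div_le (y := y) (by exact_mod_cast hy)
    rw [Nat.floor_natCast] at h3
    refine le_trans ?_ h3
    calc _ = ∑ p ∈ Ioc 2 y with p.Prime, ArithmeticFunction.vonMangoldt p / (p : ℝ) := by
          refine sum_congr rfl fun p hp ↦ ?_
          rw [ArithmeticFunction.vonMangoldt_apply_prime (mem_filter.1 hp).2]
      _ ≤ _ := by
          refine sum_le_sum_of_subset_of_nonneg (fun p hp ↦ ?_) fun d _ _ ↦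
            div_nonneg ArithmeticFunction.vonMangoldt_nonneg (by positivity)
          simp only [mem_filter, mem_Ioc] at hp ⊢
          omega
  have h3 : 0 ≤ Real.log y / L := div_nonneg (Real.log_natCast_nonneg y) hL.le
  rw [mul_div_assoc]
  nlinarith

theorem ofReal_eq_weight_mul (L : ℝ) (n : ℕ) (x : ℝ) :
    ENNReal.ofReal ((n : ℝ) ^ (-(1 + 1 / L)) * x) = weight L n * ENNReal.ofReal x := by
  rw [weight, ENNReal.ofReal_mul (by positivity)]

theorem exists_sum_large_gapDense_le {t : ℕ} (ht : 2 ≤ t) :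
    ∃ C : ℝ, 0 ≤ C ∧ ∀ L : ℝ, 1 ≤ L → ∀ S : Finset ℕ,
      (∀ m ∈ S, IsGapDense t m ∧ 72 * L ≤ Real.log m) →
        ∑ m ∈ S, (m : ℝ) ^ (-(1 + 1 / L)) * Real.log m ≤ C * L := by
  classical
  obtain ⟨C₀, hC₀, hlow⟩ := exists_lowLogSum_weight_le
  have ht0 : (0 : ℝ) < t := by exact_mod_cast (by omega : 0 < t)
  have hlogt : 0 ≤ Real.log t := Real.log_natCast_nonneg t
  refine ⟨4 * (Real.log t + C₀), by positivity, fun L hL S hS ↦ ?_⟩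
  set a : ℕ → ℝ≥0∞ := fun m ↦ weight L m * roughSum (weight L) (t * m) with ha
  set b : ℕ → ℝ := fun m ↦ if 72 * L ≤ Real.log m then Real.log m / 2 else 0 with hb
  have hb0 : ∀ m, 0 ≤ b m := fun m ↦ by
    simp only [hb]
    split_ifs
    · exact div_nonneg (Real.log_natCast_nonneg m) (by norm_num)
    · exact le_rfl
  have hpt : ∀ m : {m // IsGapDense t m}, lowLogSum (weight L) (t * m) + ENNReal.ofReal (b m) ≤
      ENNReal.ofReal (Real.log m) + ENNReal.ofReal (Real.log t + C₀) := by
    rintro ⟨m, hm⟩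
    have hm0 : (0 : ℝ) < m := by exact_mod_cast hm.pos
    simp only [hb]
    split_ifs with h
    · have h1 : lowLogSum (weight L) (t * m) ≤ ENNReal.ofReal (36 * L) := by
        refine le_trans ?_ (roughLogSum_weight_two_le hL)
        rw [← lowLogSum_add_roughLogSum (weight L) (y := t * m) (by nlinarith [hm.pos])]
        exact le_self_add
      calc _ ≤ ENNReal.ofReal (36 * L) + ENNReal.ofReal (Real.log m / 2) := by gcongr
        _ = ENNReal.ofReal (36 * L + Real.log m / 2) :=
          (ENNReal.ofReal_add (by linarith) (by linarith)).symm
        _ ≤ ENNReal.ofReal (Real.log m) := ENNReal.ofReal_le_ofReal (by linarith)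
        _ ≤ _ := le_self_add
    · rw [ENNReal.ofReal_zero, add_zero, ← ENNReal.ofReal_add (Real.log_natCast_nonneg m)
        (by positivity)]
      refine (hlow L (by linarith) _ (by nlinarith [hm.pos])).trans (ENNReal.ofReal_le_ofReal ?_)
      rw [Nat.cast_mul, Real.log_mul ht0.ne' hm0.ne']
      linarith
  have hsum : (∑' m : {m // IsGapDense t m}, a m * lowLogSum (weight L) (t * m)) +
      ∑' m : {m // IsGapDense t m}, a m * ENNReal.ofReal (b m) ≤
      (∑' m : {m // IsGapDense t m}, a m * lowLogSum (weight L) (t * m)) +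
      roughSum (weight L) 2 * ENNReal.ofReal (Real.log t + C₀) := by
    nth_rw 2 [← tsum_gapDense_mul_log_eq (by linarith) ht]
    rw [← tsum_gapDense_mul_roughSum ht (weight_mul L), ← ENNReal.tsum_mul_right,
      ← ENNReal.tsum_add, ← ENNReal.tsum_add]
    refine ENNReal.tsum_le_tsum fun m ↦ ?_
    rw [← mul_add, ← mul_add]
    exact mul_le_mul' le_rfl (hpt m)
  have hcan := (ENNReal.add_le_add_iff_left
    (tsum_gapDense_mul_log_ne_top (L := L) (by linarith) ht)).1 hsum
  have h1 : ENNReal.ofReal (∑ m ∈ S, (m : ℝ) ^ (-(1 + 1 / L)) * b m) ≤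
      ENNReal.ofReal ((1 + L) * (Real.log t + C₀)) :=
    calc _ ≤ ∑' m : {m // IsGapDense t m}, ENNReal.ofReal ((m : ℝ) ^ (-(1 + 1 / L)) * b m) :=
          ofReal_sum_le_tsum_subtype (g := fun m ↦ (m : ℝ) ^ (-(1 + 1 / L)) * b m)
            (fun m ↦ mul_nonneg (by positivity) (hb0 m)) fun m hm ↦ (hS m hm).1
      _ ≤ ∑' m : {m // IsGapDense t m}, a m * ENNReal.ofReal (b m) := by
          refine ENNReal.tsum_le_tsum fun m ↦ ?_
          rw [ofReal_eq_weight_mul]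
          gcongr
          exact le_mul_of_one_le_right' (one_le_roughSum_weight L _)
      _ ≤ _ := hcan
      _ ≤ ENNReal.ofReal (1 + L) * ENNReal.ofReal (Real.log t + C₀) := by
          gcongr
          exact roughSum_weight_le (by linarith) 2
      _ = _ := (ENNReal.ofReal_mul (by linarith)).symm
  rw [ENNReal.ofReal_le_ofReal_iff (by positivity)] at h1
  have h2 : ∑ m ∈ S, (m : ℝ) ^ (-(1 + 1 / L)) * b m =
      (∑ m ∈ S, (m : ℝ) ^ (-(1 + 1 / L)) * Real.log m) / 2 := by
    rw [Finset.sum_div]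
    refine Finset.sum_congr rfl fun m hm ↦ ?_
    simp only [hb, if_pos (hS m hm).2]
    ring
  rw [h2] at h1
  have h3 : 0 ≤ Real.log t + C₀ := by positivity
  nlinarith

theorem rpow_neg_le_inv {L : ℝ} (hL : 0 < L) (m : ℕ) :
    (m : ℝ) ^ (-(1 + 1 / L)) ≤ (m : ℝ)⁻¹ := by
  rcases Nat.eq_zero_or_pos m with rfl | hm
  · have : 0 < 1 / L := by positivity
    rw [Nat.cast_zero, Real.zero_rpow (by linarith), inv_zero]
  rw [← Real.rpow_neg_one (m : ℝ)]
  refine Real.rpow_le_rpow_of_exponent_le (Nat.one_le_cast.2 hm) ?_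
  have : 0 < 1 / L := by positivity
  linarith

theorem inv_le_exp_mul_rpow {L A : ℝ} (hL : 0 < L) {m : ℕ} (hm : 0 < m)
    (h : Real.log m ≤ A * L) : (m : ℝ)⁻¹ ≤ Real.exp A * (m : ℝ) ^ (-(1 + 1 / L)) := by
  have hm' : (0 : ℝ) < m := by exact_mod_cast hm
  rw [show -(1 + 1 / L) = -(1 / L) + -1 by ring, Real.rpow_add hm', Real.rpow_neg_one, ← mul_assoc,
    Real.rpow_def_of_pos hm', ← Real.exp_add]
  refine le_mul_of_one_le_left (by positivity) (Real.one_le_exp ?_)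
  have : Real.log m / L ≤ A := by rwa [div_le_iff₀ hL]
  have h6 : Real.log m * -(1 / L) = -(Real.log m / L) := by ring
  linarith

theorem exists_sum_gapDense_inv_mul_log_le {t : ℕ} (ht : 2 ≤ t) :
    ∃ C : ℝ, 0 ≤ C ∧ ∀ L : ℝ, 1 ≤ L → ∀ S : Finset ℕ,
      (∀ m ∈ S, IsGapDense t m ∧ Real.log m ≤ 72 * L) →
        ∑ m ∈ S, (m : ℝ)⁻¹ * Real.log m ≤ C * L := by
  classical
  obtain ⟨C, hC, h⟩ := exists_sum_large_gapDense_le ht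
  set K : ℝ := Real.exp 144 * C with hK
  set B : ℝ := Real.exp 144 * (2 * (144 : ℝ)) with hB
  have hind : ∀ k : ℕ, ∀ L : ℝ, 1 ≤ L → L ≤ 2 ^ k → ∀ S : Finset ℕ,
      (∀ m ∈ S, IsGapDense t m ∧ Real.log m ≤ 72 * L) →
        ∑ m ∈ S, (m : ℝ)⁻¹ * Real.log m ≤ B + K * L := by
    intro k
    induction k with
    | zero =>
      intro L hL hLk S hS
      obtain rfl : L = 1 := le_antisymm (by simpa using hLk) hL
      have h1 : ∑ m ∈ S, (m : ℝ)⁻¹ * Real.log m ≤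
          ∑ m ∈ S, Real.exp 144 * 72 * (m : ℝ) ^ (-(1 + 1 / (1 : ℝ))) := by
        refine Finset.sum_le_sum fun m hm ↦ ?_
        have h2 := (hS m hm).2
        have h3 := inv_le_exp_mul_rpow (L := 1) (A := 144) one_pos (hS m hm).1.pos (by linarith)
        calc _ ≤ Real.exp 144 * (m : ℝ) ^ (-(1 + 1 / (1 : ℝ))) * 72 :=
              mul_le_mul h3 (by linarith) (Real.log_natCast_nonneg m) (by positivity)
          _ = _ := by ring
      rw [← Finset.mul_sum] at h1
      have h2 := sum_rpow_le (L := 1) one_pos S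
      have h3 : 0 ≤ K := by positivity
      have h4 : 0 < Real.exp 144 := Real.exp_pos _
      nlinarith
    | succ k ih =>
      intro L hL hLk S hS
      rcases le_total L 2 with hL2 | hL2
      · rcases le_total L (2 ^ k) with hLk' | hLk'
        · exact ih L hL hLk' S hS
        have h1 : ∑ m ∈ S, (m : ℝ)⁻¹ * Real.log m ≤
            ∑ m ∈ S, Real.exp 144 * 144 * (m : ℝ) ^ (-(1 + 1 / (1 : ℝ))) := by
          refine Finset.sum_le_sum fun m hm ↦ ?_
          have h2 := (hS m hm).2
          have h3 := inv_le_exp_mul_rpow (L := 1) (A := 144) one_pos (hS m hm).1.pos (by linarith)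
          calc _ ≤ Real.exp 144 * (m : ℝ) ^ (-(1 + 1 / (1 : ℝ))) * 144 :=
                mul_le_mul h3 (by linarith) (Real.log_natCast_nonneg m) (by positivity)
            _ = _ := by ring
        rw [← Finset.mul_sum] at h1
        have h2 := sum_rpow_le (L := 1) one_pos S
        have h3 : 0 ≤ K := by positivity
        have h4 : 0 < Real.exp 144 := Real.exp_pos _
        nlinarith
      · have h1 := ih (L / 2) (by linarith) (by rw [pow_succ] at hLk; linarith)
          {m ∈ S | Real.log m ≤ 72 * (L / 2)} fun m hm ↦
            ⟨(hS m (Finset.mem_filter.1 hm).1).1, (Finset.mem_filter.1 hm).2⟩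
        have h2 := h (L / 2) (by linarith) {m ∈ S | ¬ Real.log m ≤ 72 * (L / 2)} fun m hm ↦
            ⟨(hS m (Finset.mem_filter.1 hm).1).1, (not_le.1 (Finset.mem_filter.1 hm).2).le⟩
        have h3 : ∑ m ∈ S.filter (fun m : ℕ ↦ ¬ Real.log m ≤ 72 * (L / 2)), (m : ℝ)⁻¹ * Real.log m ≤
            Real.exp 144 * ∑ m ∈ S.filter (fun m : ℕ ↦ ¬ Real.log m ≤ 72 * (L / 2)),
              (m : ℝ) ^ (-(1 + 1 / (L / 2))) * Real.log m := by
          rw [Finset.mul_sum]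
          refine Finset.sum_le_sum fun m hm ↦ ?_
          rw [← mul_assoc]
          obtain ⟨hmd, hml⟩ := hS m (Finset.mem_filter.1 hm).1
          exact mul_le_mul_of_nonneg_right
            (inv_le_exp_mul_rpow (by linarith) hmd.pos (by linarith)) (Real.log_natCast_nonneg m)
        have h4 : Real.exp 144 * ∑ m ∈ S.filter (fun m : ℕ ↦ ¬ Real.log m ≤ 72 * (L / 2)),
              (m : ℝ) ^ (-(1 + 1 / (L / 2))) * Real.log m ≤ Real.exp 144 * (C * (L / 2)) := by
          gcongr
        have h5 : Real.exp 144 * (C * (L / 2)) = K * (L / 2) := by rw [hK]; ring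
        rw [← Finset.sum_filter_add_sum_filter_not S fun m : ℕ ↦ Real.log m ≤ 72 * (L / 2)]
        linarith
  refine ⟨B + K, by positivity, fun L hL S hS ↦ ?_⟩
  obtain ⟨k, hk⟩ := pow_unbounded_of_one_lt L (one_lt_two : (1 : ℝ) < 2)
  have := hind k L hL hk.le S hS
  have h3 : 0 ≤ B := by positivity
  nlinarith

theorem exists_sum_gapDense_rpow_mul_log_le {t : ℕ} (ht : 2 ≤ t) :
    ∃ C : ℝ, 0 < C ∧ ∀ L : ℝ, 1 ≤ L → ∀ S : Finset ℕ, (∀ m ∈ S, IsGapDense t m) →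
        ∑ m ∈ S, (m : ℝ) ^ (-(1 + 1 / L)) * Real.log m ≤ C * L := by
  classical
  obtain ⟨C₁, hC₁, h₁⟩ := exists_sum_large_gapDense_le ht
  obtain ⟨C₂, hC₂, h₂⟩ := exists_sum_gapDense_inv_mul_log_le ht
  refine ⟨C₂ + C₁ + 1, by positivity, fun L hL S hS ↦ ?_⟩
  rw [← Finset.sum_filter_add_sum_filter_not S fun m : ℕ ↦ Real.log m ≤ 72 * L]
  have h3 := h₁ L hL {m ∈ S | ¬ Real.log m ≤ 72 * L} fun m hm ↦
    ⟨hS m (Finset.mem_filter.1 hm).1, (not_le.1 (Finset.mem_filter.1 hm).2).le⟩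
  have h4 := h₂ L hL {m ∈ S | Real.log m ≤ 72 * L} fun m hm ↦
    ⟨hS m (Finset.mem_filter.1 hm).1, (Finset.mem_filter.1 hm).2⟩
  have h5 : ∑ m ∈ S.filter (fun m : ℕ ↦ Real.log m ≤ 72 * L), (m : ℝ) ^ (-(1 + 1 / L)) * Real.log m ≤
      ∑ m ∈ S.filter (fun m : ℕ ↦ Real.log m ≤ 72 * L), (m : ℝ)⁻¹ * Real.log m := by
    refine Finset.sum_le_sum fun m _ ↦ ?_
    exact mul_le_mul_of_nonneg_right (rpow_neg_le_inv (by linarith) m) (Real.log_natCast_nonneg m)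
  linarith

theorem exists_one_le_tsum_gapDense : ∃ t : ℕ, 3 ≤ t ∧ ∀ L : ℝ, 1 ≤ L →
    1 ≤ ∑' m : {m // IsGapDense t m},
      ENNReal.ofReal ((m : ℝ) ^ (-(1 + 1 / L)) * (42 * Real.log (t * m : ℕ) / L)) := by
  obtain ⟨C, hC, hlow⟩ := exists_le_lowLogSum_weight
  obtain ⟨t, ht3, htC⟩ : ∃ t : ℕ, 3 ≤ t ∧ C + 1 ≤ Real.log t := by
    refine ⟨max 3 ⌈Real.exp (C + 1)⌉₊, le_max_left _ _, ?_⟩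
    rw [Real.le_log_iff_exp_le (by positivity)]
    exact (Nat.le_ceil _).trans (by exact_mod_cast le_max_right _ _)
  refine ⟨t, ht3, fun L hL ↦ ?_⟩
  have ht : 2 ≤ t := by omega
  have hL0 : 0 < L := by linarith
  have ht0 : (0 : ℝ) < t := by exact_mod_cast (by omega : 0 < t)
  set a : ℕ → ℝ≥0∞ := fun m ↦ weight L m * roughSum (weight L) (t * m) with ha
  set ℓ : ℕ → ℝ := fun m ↦ Real.log (t * m : ℕ) with hℓ
  set b : ℕ → ℝ := fun m ↦ min (ℓ m) (7 * ℓ m ^ 2 / L) with hb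
  have hℓm : ∀ m, IsGapDense t m → ℓ m = Real.log t + Real.log m := by
    intro m hm
    have hm0 : (0 : ℝ) < m := by exact_mod_cast hm.pos
    simp only [hℓ]
    rw [Nat.cast_mul, Real.log_mul ht0.ne' hm0.ne']
  have hℓ1 : ∀ m, IsGapDense t m → 1 ≤ ℓ m := by
    intro m hm
    rw [hℓm m hm]
    linarith [Real.log_natCast_nonneg m]
  have hpt : ∀ m : {m // IsGapDense t m}, ENNReal.ofReal (Real.log m) + 1 ≤
      lowLogSum (weight L) (t * m) + ENNReal.ofReal (b m) := by
    rintro ⟨m, hm⟩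
    have h1 := hℓ1 m hm
    have h2 := hℓm m hm
    simp only [hb]
    rw [← ENNReal.ofReal_one, ← ENNReal.ofReal_add (Real.log_natCast_nonneg m) zero_le_one]
    rcases min_choice (ℓ m) (7 * ℓ m ^ 2 / L) with h | h
    · rw [h]
      exact (ENNReal.ofReal_le_ofReal (by linarith)).trans le_add_self
    · rw [h]
      refine le_trans ?_ (add_le_add_left (hlow L hL0 (t * m) (by nlinarith [hm.pos])) _)
      refine le_trans (ENNReal.ofReal_le_ofReal ?_) ENNReal.ofReal_add_le
      change _ ≤ ℓ m - C - (ℓ m + 6) * ℓ m / L + 7 * ℓ m ^ 2 / L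
      have h3 : (ℓ m + 6) * ℓ m / L ≤ 7 * ℓ m ^ 2 / L :=
        div_le_div_of_nonneg_right (by nlinarith) hL0.le
      linarith
  have hsum : (∑' m : {m // IsGapDense t m}, a m * lowLogSum (weight L) (t * m)) +
      roughSum (weight L) 2 ≤
      (∑' m : {m // IsGapDense t m}, a m * lowLogSum (weight L) (t * m)) +
      ∑' m : {m // IsGapDense t m}, a m * ENNReal.ofReal (b m) := by
    nth_rw 1 [← tsum_gapDense_mul_log_eq (by linarith) ht]
    rw [← tsum_gapDense_mul_roughSum ht (weight_mul L),
      ← ENNReal.tsum_add, ← ENNReal.tsum_add]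
    refine ENNReal.tsum_le_tsum fun m ↦ ?_
    calc _ = a m * (ENNReal.ofReal (Real.log m) + 1) := by rw [mul_add, mul_one]
      _ ≤ a m * (lowLogSum (weight L) (t * m) + ENNReal.ofReal (b m)) :=
        mul_le_mul' le_rfl (hpt m)
      _ = _ := mul_add _ _ _
  have hcan := (ENNReal.add_le_add_iff_left
    (tsum_gapDense_mul_log_ne_top (L := L) (by linarith) ht)).1 hsum
  set X := roughSum (weight L) 2 with hX
  have hX1 : 1 ≤ X := one_le_roughSum_weight L 2
  have hXtop : X ≠ ⊤ := ((roughSum_weight_le hL0 2).trans_lt ENNReal.ofReal_lt_top).ne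
  have hterm : ∀ m : {m // IsGapDense t m}, a m * ENNReal.ofReal (b m) ≤
      X * ENNReal.ofReal ((m : ℝ) ^ (-(1 + 1 / L)) * (42 * Real.log (t * m : ℕ) / L)) := by
    rintro ⟨m, hm⟩
    have h1 := hℓ1 m hm
    have h2 : b m ≤ 7 * ℓ m / L * min (ℓ m) L := by
      rcases le_total (ℓ m) L with h | h
      · rw [min_eq_left h]
        refine (min_le_right _ _).trans (le_of_eq ?_)
        ring
      · rw [min_eq_right h]
        refine (min_le_left _ _).trans ?_
        rw [div_mul_cancel₀ _ hL0.ne']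
        linarith
    have h3 := roughSum_weight_mul_min_log_le hL0 (y := t * m) (by nlinarith [hm.pos])
    have h4 : 0 ≤ 7 * ℓ m / L := by positivity
    calc a m * ENNReal.ofReal (b m) ≤
          a m * (ENNReal.ofReal (7 * ℓ m / L) * ENNReal.ofReal (min (ℓ m) L)) := by
          gcongr
          rw [← ENNReal.ofReal_mul h4]
          exact ENNReal.ofReal_le_ofReal h2
      _ = weight L m * ENNReal.ofReal (7 * ℓ m / L) *
          (roughSum (weight L) (t * m) * ENNReal.ofReal (min (ℓ m) L)) := by
          simp only [ha]
          ring
      _ ≤ weight L m * ENNReal.ofReal (7 * ℓ m / L) * (6 * X) := by gcongr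
      _ = X * (weight L m * (ENNReal.ofReal 6 * ENNReal.ofReal (7 * ℓ m / L))) := by
          rw [show ENNReal.ofReal 6 = 6 by norm_num]
          ring
      _ = _ := by
          rw [ofReal_eq_weight_mul, ← ENNReal.ofReal_mul (by norm_num)]
          congr 3
          simp only [hℓ]
          ring
  have h5 : X * 1 ≤ X * ∑' m : {m // IsGapDense t m},
      ENNReal.ofReal ((m : ℝ) ^ (-(1 + 1 / L)) * (42 * Real.log (t * m : ℕ) / L)) := by
    rw [mul_one, ← ENNReal.tsum_mul_left]
    exact hcan.trans (ENNReal.tsum_le_tsum hterm)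
  exact (ENNReal.mul_le_mul_iff_right (by positivity) hXtop).1 h5

theorem exists_le_sum_gapDense_rpow_mul_log : ∃ t : ℕ, 3 ≤ t ∧ ∃ c L₀ : ℝ, 0 < c ∧ 1 ≤ L₀ ∧
    ∀ L : ℝ, L₀ ≤ L → ∃ S : Finset ℕ, (∀ m ∈ S, IsGapDense t m) ∧
      c * L ≤ ∑ m ∈ S, (m : ℝ) ^ (-(1 + 1 / L)) * Real.log m := by
  classical
  obtain ⟨t, ht, h⟩ := exists_one_le_tsum_gapDense
  have hlogt : 0 ≤ Real.log t := Real.log_natCast_nonneg t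
  have ht0 : (0 : ℝ) < t := by exact_mod_cast (by omega : 0 < t)
  refine ⟨t, ht, 1 / (168 * (1 + Real.log t)), 1 + 168 * Real.log t, by positivity, by linarith,
    fun L hL ↦ ?_⟩
  have hL1 : 1 ≤ L := by linarith
  have hL0 : 0 < L := by linarith
  have h1 : ENNReal.ofReal (1 / 2) < ∑' m : {m // IsGapDense t m},
      ENNReal.ofReal ((m : ℝ) ^ (-(1 + 1 / L)) * (42 * Real.log (t * m : ℕ) / L)) := by
    refine lt_of_lt_of_le ?_ (h L hL1)
    rw [ENNReal.ofReal_lt_one]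
    norm_num
  rw [ENNReal.tsum_eq_iSup_sum, lt_iSup_iff] at h1
  obtain ⟨S, hS⟩ := h1
  have hnn : ∀ m : {m // IsGapDense t m},
      0 ≤ (m : ℝ) ^ (-(1 + 1 / L)) * (42 * Real.log (t * m : ℕ) / L) := fun m ↦ by
    have := Real.log_natCast_nonneg (t * m : ℕ)
    positivity
  rw [← ENNReal.ofReal_sum_of_nonneg fun m _ ↦ hnn m, ENNReal.ofReal_lt_ofReal_iff_of_nonneg
    (by norm_num)] at hS
  set T := S.map (Function.Embedding.subtype _) with hT
  have hTd : ∀ m ∈ T, IsGapDense t m := by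
    intro m hm
    obtain ⟨n, -, rfl⟩ := Finset.mem_map.1 hm
    exact n.2
  refine ⟨T, hTd, ?_⟩
  have h2 : ∑ m ∈ S, (m : ℝ) ^ (-(1 + 1 / L)) * (42 * Real.log (t * m : ℕ) / L) =
      (∑ m ∈ T, (m : ℝ) ^ (-(1 + 1 / L)) * Real.log (t * m : ℕ)) * (42 / L) := by
    rw [hT, Finset.sum_map, Finset.sum_mul]
    refine Finset.sum_congr rfl fun m _ ↦ ?_
    simp only [Function.Embedding.subtype_apply]
    ring
  rw [h2, mul_div_assoc', lt_div_iff₀ hL0] at hS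
  have h3 : ∑ m ∈ T, (m : ℝ) ^ (-(1 + 1 / L)) * Real.log (t * m : ℕ) ≤
      ∑ m ∈ T, ((1 + Real.log t) * ((m : ℝ) ^ (-(1 + 1 / L)) * Real.log m) +
        if m = 1 then Real.log t else 0) := by
    refine Finset.sum_le_sum fun m hm ↦ ?_
    have hmd := hTd m hm
    have hm0 : (0 : ℝ) < m := by exact_mod_cast hmd.pos
    split_ifs with hm1
    · simp [hm1]
    · have h3m : 3 ≤ m := by
        by_contra! hlt
        have := hmd.pos
        obtain rfl : m = 2 := by omega
        exact absurd (hmd.1.2 2 Nat.prime_two dvd_rfl) (lt_irrefl _)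
      have h1m : 1 ≤ Real.log m := by
        rw [Real.le_log_iff_exp_le hm0]
        have : (3 : ℝ) ≤ m := by exact_mod_cast h3m
        linarith [Real.exp_one_lt_d9]
      rw [Nat.cast_mul, Real.log_mul ht0.ne' hm0.ne', add_zero, mul_left_comm]
      refine mul_le_mul_of_nonneg_left ?_ (by positivity)
      nlinarith
  rw [Finset.sum_add_distrib, ← Finset.mul_sum, Finset.sum_ite_eq'] at h3
  have h4 : (if 1 ∈ T then Real.log t else 0) ≤ Real.log t := by split_ifs <;> simp [hlogt]
  rw [div_mul_eq_mul_div, one_mul, div_le_iff₀ (by positivity)]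
  linarith

theorem exists_window_sum_gapDense_inv : ∃ t : ℕ, 3 ≤ t ∧ ∃ ε K c L₀ : ℝ,
    0 < ε ∧ 0 < K ∧ 0 < c ∧ 1 ≤ L₀ ∧ ∀ L : ℝ, L₀ ≤ L → ∃ S : Finset ℕ,
      (∀ m ∈ S, IsGapDense t m ∧ ε * L < Real.log m ∧ Real.log m ≤ K * L) ∧
        c ≤ ∑ m ∈ S, (m : ℝ)⁻¹ := by
  classical
  obtain ⟨t, ht, c, L₀, hc, hL₀, hlow⟩ := exists_le_sum_gapDense_rpow_mul_log
  obtain ⟨C, hC, hup⟩ := exists_sum_gapDense_rpow_mul_log_le (t := t) (by omega)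
  set ε := c / (12 * C) with hε
  have hε0 : 0 < ε := by positivity
  obtain ⟨K, hK0, hK⟩ : ∃ K : ℝ, 0 < K ∧ 2 * C * Real.exp (-(K / 2)) ≤ c / 4 := by
    refine ⟨16 * C / c, by positivity, ?_⟩
    rw [Real.exp_neg, ← div_eq_mul_inv, div_le_iff₀ (Real.exp_pos _)]
    have := Real.add_one_le_exp (16 * C / c / 2)
    calc 2 * C = c / 4 * (16 * C / c / 2) := by field_simp; ring
      _ ≤ _ := by gcongr; linarith
  refine ⟨t, ht, ε, K, c / (2 * K), max L₀ (1 / ε), hε0, hK0, by positivity,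
    hL₀.trans (le_max_left _ _), fun L hL ↦ ?_⟩
  have hL1 : 1 ≤ L := hL₀.trans ((le_max_left _ _).trans hL)
  have hL0 : 0 < L := by linarith
  have hεL : 1 ≤ ε * L := by
    have := (le_max_right _ _).trans hL
    rwa [div_le_iff₀' hε0] at this
  obtain ⟨S, hS, hSL⟩ := hlow L ((le_max_left _ _).trans hL)
  set A := S.filter fun m : ℕ ↦ Real.log m ≤ ε * L with hA
  set A' := S.filter fun m : ℕ ↦ ¬ Real.log m ≤ ε * L with hA'
  set B := A'.filter fun m : ℕ ↦ Real.log m ≤ K * L with hB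
  set B' := A'.filter fun m : ℕ ↦ ¬ Real.log m ≤ K * L with hB'
  refine ⟨B, fun m hm ↦ ?_, ?_⟩
  · obtain ⟨hmA, hm2⟩ := Finset.mem_filter.1 hm
    obtain ⟨hmS, hm1⟩ := Finset.mem_filter.1 hmA
    exact ⟨hS m hmS, not_le.1 hm1, hm2⟩
  have hsplit : ∑ m ∈ S, (m : ℝ) ^ (-(1 + 1 / L)) * Real.log m =
      ∑ m ∈ A, (m : ℝ) ^ (-(1 + 1 / L)) * Real.log m +
      (∑ m ∈ B, (m : ℝ) ^ (-(1 + 1 / L)) * Real.log m +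
        ∑ m ∈ B', (m : ℝ) ^ (-(1 + 1 / L)) * Real.log m) := by
    rw [hB, hB', Finset.sum_filter_add_sum_filter_not, hA, hA',
      Finset.sum_filter_add_sum_filter_not]
  have hAle : ∑ m ∈ A, (m : ℝ) ^ (-(1 + 1 / L)) * Real.log m ≤ c / 4 * L :=
    calc _ ≤ ∑ m ∈ A, 3 * ((m : ℝ) ^ (-(1 + 1 / (ε * L))) * Real.log m) := by
          refine Finset.sum_le_sum fun m hm ↦ ?_
          obtain ⟨hmS, hm1⟩ := Finset.mem_filter.1 hm
          rw [← mul_assoc]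
          refine mul_le_mul_of_nonneg_right ?_ (Real.log_natCast_nonneg m)
          refine (rpow_neg_le_inv hL0 m).trans ((inv_le_exp_mul_rpow (L := ε * L) (A := 1)
            (by positivity) (hS m hmS).pos (by linarith)).trans ?_)
          refine mul_le_mul_of_nonneg_right ?_ (by positivity)
          linarith [Real.exp_one_lt_d9]
      _ ≤ 3 * (C * (ε * L)) := by
          rw [← Finset.mul_sum]
          gcongr
          exact hup _ hεL A fun m hm ↦ hS m (Finset.mem_filter.1 hm).1
      _ = c / 4 * L := by
          rw [hε]
          field_simp
          norm_num
  have hB'le : ∑ m ∈ B', (m : ℝ) ^ (-(1 + 1 / L)) * Real.log m ≤ c / 4 * L :=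
    calc _ ≤ ∑ m ∈ B', Real.exp (-(K / 2)) * ((m : ℝ) ^ (-(1 + 1 / (2 * L))) * Real.log m) := by
          refine Finset.sum_le_sum fun m hm ↦ ?_
          obtain ⟨hmA, hm2⟩ := Finset.mem_filter.1 hm
          have hm0 : (0 : ℝ) < m := by
            exact_mod_cast (hS m (Finset.mem_filter.1 hmA).1).pos
          rw [← mul_assoc]
          refine mul_le_mul_of_nonneg_right ?_ (Real.log_natCast_nonneg m)
          rw [show -(1 + 1 / L) = -(1 / (2 * L)) + -(1 + 1 / (2 * L)) by field_simp; ring,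
            Real.rpow_add hm0]
          refine mul_le_mul_of_nonneg_right ?_ (by positivity)
          rw [Real.rpow_def_of_pos hm0]
          refine Real.exp_le_exp.2 ?_
          have h1 : Real.log m * -(1 / (2 * L)) = -(Real.log m / L / 2) := by field_simp
          have h2 : K ≤ Real.log m / L := by
            rw [le_div_iff₀ hL0]
            exact (not_le.1 hm2).le
          rw [h1]
          linarith
      _ ≤ Real.exp (-(K / 2)) * (C * (2 * L)) := by
          rw [← Finset.mul_sum]
          gcongr
          exact hup _ (by linarith) B' fun m hm ↦
            hS m (Finset.mem_filter.1 (Finset.mem_filter.1 hm).1).1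
      _ = 2 * C * Real.exp (-(K / 2)) * L := by ring
      _ ≤ c / 4 * L := by gcongr
  have hBle : ∑ m ∈ B, (m : ℝ) ^ (-(1 + 1 / L)) * Real.log m ≤ (∑ m ∈ B, (m : ℝ)⁻¹) * (K * L) := by
    rw [Finset.sum_mul]
    refine Finset.sum_le_sum fun m hm ↦ ?_
    exact mul_le_mul (rpow_neg_le_inv hL0 m) (Finset.mem_filter.1 hm).2
      (Real.log_natCast_nonneg m) (by positivity)
  have h1 : c / 2 * L ≤ (∑ m ∈ B, (m : ℝ)⁻¹) * K * L := by
    rw [mul_assoc]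
    linarith
  have h2 := le_of_mul_le_mul_right h1 hL0
  rw [div_le_iff₀ (by positivity)]
  linarith

open Finset in
/-- The primes in the real interval `(a, b]`. -/
noncomputable def primesIoc (a b : ℝ) : Finset ℕ := {p ∈ Ioc ⌊a⌋₊ ⌊b⌋₊ | p.Prime}

theorem mem_primesIoc {a b : ℝ} (ha : 0 ≤ a) {p : ℕ} :
    p ∈ primesIoc a b ↔ p.Prime ∧ a < p ∧ (p : ℝ) ≤ b := by
  simp only [primesIoc, Finset.mem_filter, Finset.mem_Ioc, Nat.floor_lt ha]
  constructor
  · rintro ⟨⟨h1, h2⟩, hp⟩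
    exact ⟨hp, h1, (Nat.le_floor_iff' hp.ne_zero).1 h2⟩
  · rintro ⟨hp, h1, h2⟩
    exact ⟨⟨h1, (Nat.le_floor_iff' hp.ne_zero).2 h2⟩, hp⟩

theorem exists_half_le_theta : ∃ x₀ : ℝ, 1 ≤ x₀ ∧ ∀ x : ℝ, x₀ ≤ x → x / 2 ≤ Chebyshev.theta x := by
  refine ⟨50 ^ 4, by norm_num, fun x hx ↦ ?_⟩
  have hx0 : 0 < x := lt_of_lt_of_le (by norm_num) hx
  have hx1 : 1 ≤ x := le_trans (by norm_num) hx
  have h := Chebyshev.theta_ge' hx1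
  obtain ⟨w, hw, rfl⟩ : ∃ w : ℝ, 50 ≤ w ∧ w ^ 4 = x := by
    refine ⟨√√x, ?_, ?_⟩
    · refine Real.le_sqrt_of_sq_le (Real.le_sqrt_of_sq_le ?_)
      linarith
    · rw [show (4 : ℕ) = 2 * 2 by rfl, pow_mul, Real.sq_sqrt (Real.sqrt_nonneg _),
        Real.sq_sqrt hx0.le]
  have hsq : √(w ^ 4) = w ^ 2 := by
    rw [show w ^ 4 = (w ^ 2) ^ 2 by ring]
    exact Real.sqrt_sq (by positivity)
  have hlog : Real.log (w ^ 4) ≤ 4 * w := by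
    rw [Real.log_pow]
    have := Real.log_le_self (x := w) (by linarith)
    push_cast
    linarith
  have hlog2 : Real.log (w ^ 4 + 2) ≤ 4 * w + 2 := by
    have h1 : w ^ 4 + 2 ≤ w ^ 4 * 3 := by linarith
    have h2 : Real.log (w ^ 4 + 2) ≤ Real.log (w ^ 4 * 3) := Real.log_le_log (by positivity) h1
    rw [Real.log_mul (by positivity) (by norm_num)] at h2
    have h3 := Real.log_le_sub_one_of_pos (x := 3) (by norm_num)
    linarith
  rw [hsq] at h
  have h4 : 2 * w ^ 2 * Real.log (w ^ 4) ≤ 2 * w ^ 2 * (4 * w) := by gcongr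
  have h5 := Real.log_two_gt_d9
  have h6 : (w ^ 4 - 1) * 0.69 ≤ (w ^ 4 - 1) * Real.log 2 := by
    refine mul_le_mul_of_nonneg_left (by linarith) (by linarith)
  have h7 : 50 * w ^ 3 ≤ w ^ 4 := by
    rw [pow_succ w 3]
    nlinarith [pow_pos (by linarith : 0 < w) 3]
  have h8 : 2500 * w ≤ w ^ 3 := by
    have : 2500 ≤ w ^ 2 := by nlinarith
    rw [pow_succ w 2]
    nlinarith
  nlinarith

theorem exists_le_card_primesIoc : ∃ x₀ : ℝ, 1 ≤ x₀ ∧ ∀ a b : ℝ, 0 ≤ a → a ≤ b / 8 → x₀ ≤ b →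
    b / 4 ≤ (primesIoc a b).card * Real.log b := by
  obtain ⟨x₀, hx₀, h⟩ := exists_half_le_theta
  refine ⟨x₀, hx₀, fun a b ha hab hb ↦ ?_⟩
  have h1 := h b hb
  have hab' : a ≤ b := by linarith
  have h2 := Chebyshev.theta_le_log4_mul_x ha
  have h4 : Real.log 4 ≤ 2 := by
    rw [show (4 : ℝ) = 2 ^ 2 by norm_num, Real.log_pow]
    have := Real.log_two_lt_d9
    push_cast
    linarith
  have h3 : Chebyshev.theta b = Chebyshev.theta a + ∑ p ∈ primesIoc a b, Real.log p := by
    rw [Chebyshev.theta, Chebyshev.theta, primesIoc, ← Finset.sum_union]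
    · congr 1
      rw [← Finset.filter_union, Finset.Ioc_union_Ioc_eq_Ioc (Nat.zero_le _)
        (Nat.floor_mono hab')]
    · refine Finset.disjoint_filter_filter ?_
      exact Finset.Ioc_disjoint_Ioc_of_le le_rfl
  have h5 : ∑ p ∈ primesIoc a b, Real.log p ≤ (primesIoc a b).card * Real.log b := by
    rw [← nsmul_eq_mul]
    refine Finset.sum_le_card_nsmul _ _ _ fun p hp ↦ ?_
    obtain ⟨hp, -, hpb⟩ := (mem_primesIoc ha).1 hp
    exact Real.log_le_log (by exact_mod_cast hp.pos) hpb
  nlinarith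

theorem exists_le_sum_primesIoc_inv : ∃ C : ℝ, 0 ≤ C ∧ ∀ a b : ℝ, 1 ≤ a → a ≤ b →
    (b - a - C) / b ≤ ∑ p ∈ primesIoc (Real.exp a) (Real.exp b), (p : ℝ)⁻¹ := by
  obtain ⟨C, hC, h⟩ := exists_le_sum_log_prime_div
  refine ⟨C + 6, by linarith, fun a b ha hab ↦ ?_⟩
  have h1 := h (Real.exp b) (Real.one_le_exp (by linarith))
  have h2 := sum_vonMangoldt_div_le (y := Real.exp a) (Real.one_le_exp (by linarith))
  rw [Real.log_exp] at h1 h2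
  have h2a : 2 ≤ ⌊Real.exp a⌋₊ := Nat.le_floor (by
    have := Real.add_one_le_exp a
    push_cast
    linarith)
  have h3 : ∑ p ∈ Finset.Ioc 2 ⌊Real.exp b⌋₊ with p.Prime, Real.log p / p =
      ∑ p ∈ Finset.Ioc 2 ⌊Real.exp a⌋₊ with p.Prime, Real.log p / p +
      ∑ p ∈ primesIoc (Real.exp a) (Real.exp b), Real.log p / p := by
    rw [primesIoc, ← Finset.sum_union]
    · congr 1
      rw [← Finset.filter_union, Finset.Ioc_union_Ioc_eq_Ioc h2a
        (Nat.floor_mono (Real.exp_le_exp.2 hab))]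
    · refine Finset.disjoint_filter_filter ?_
      exact Finset.Ioc_disjoint_Ioc_of_le le_rfl
  have h4 : ∑ p ∈ Finset.Ioc 2 ⌊Real.exp a⌋₊ with p.Prime, Real.log p / p ≤
      ∑ d ∈ Finset.Ioc 0 ⌊Real.exp a⌋₊, ArithmeticFunction.vonMangoldt d / d :=
    calc _ = ∑ p ∈ Finset.Ioc 2 ⌊Real.exp a⌋₊ with p.Prime,
          ArithmeticFunction.vonMangoldt p / (p : ℝ) := by
          refine Finset.sum_congr rfl fun p hp ↦ ?_
          rw [ArithmeticFunction.vonMangoldt_apply_prime (Finset.mem_filter.1 hp).2]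
      _ ≤ _ := by
          refine Finset.sum_le_sum_of_subset_of_nonneg (fun p hp ↦ ?_) fun d _ _ ↦
            div_nonneg ArithmeticFunction.vonMangoldt_nonneg (by positivity)
          simp only [Finset.mem_filter, Finset.mem_Ioc] at hp ⊢
          omega
  have h5 : ∑ p ∈ primesIoc (Real.exp a) (Real.exp b), Real.log p / p ≤
      ∑ p ∈ primesIoc (Real.exp a) (Real.exp b), b * (p : ℝ)⁻¹ := by
    refine Finset.sum_le_sum fun p hp ↦ ?_
    obtain ⟨hp, -, hpb⟩ := (mem_primesIoc (Real.exp_pos a).le).1 hp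
    rw [div_eq_mul_inv]
    have : Real.log p ≤ b := (Real.log_le_iff_le_exp (by exact_mod_cast hp.pos)).2 hpb
    gcongr
  rw [← Finset.mul_sum] at h5
  rw [div_le_iff₀' (by linarith)]
  linarith

/-- The `t`-gap-dense integers whose logarithm lies in `(a, b]`. -/
noncomputable def gapDenseWindow (t : ℕ) (a b : ℝ) : Finset ℕ :=
  open Classical in
  {m ∈ Finset.range (⌊Real.exp b⌋₊ + 1) | IsGapDense t m ∧ a < Real.log m ∧ Real.log m ≤ b}

theorem mem_gapDenseWindow {t : ℕ} {a b : ℝ} {m : ℕ} :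
    m ∈ gapDenseWindow t a b ↔ IsGapDense t m ∧ a < Real.log m ∧ Real.log m ≤ b := by
  simp only [gapDenseWindow, Finset.mem_filter, Finset.mem_range, and_iff_right_iff_imp]
  rintro ⟨hm, -, hb⟩
  rw [Nat.lt_succ_iff, Nat.le_floor_iff (Real.exp_pos b).le]
  exact (Real.log_le_iff_le_exp (by exact_mod_cast hm.pos)).1 hb

open Finset in
theorem sum_mul_prime_le {S T : Finset ℕ} {Q : ℕ → Finset ℕ} {F : ℕ → ℝ} {w : ℝ} {k : ℕ}
    (hw : 0 < w) (hF : ∀ n, 0 ≤ F n)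
    (hQ : ∀ m ∈ S, ∀ p ∈ Q m, p.Prime ∧ w ≤ Real.log p ∧ m * p ∈ T)
    (hT : ∀ n ∈ T, n ≠ 0 ∧ Real.log n ≤ k * w) :
    ∑ m ∈ S, ∑ p ∈ Q m, F (m * p) ≤ k * ∑ n ∈ T, F n := by
  classical
  rw [Finset.sum_sigma' S Q fun m p ↦ F (m * p),
    ← sum_fiberwise_of_maps_to (t := T) (g := fun x : (_ : ℕ) × ℕ ↦ x.1 * x.2) (fun x hx ↦ by
      obtain ⟨h1, h2⟩ := mem_sigma.1 hx
      exact (hQ _ h1 _ h2).2.2), mul_sum]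
  refine sum_le_sum fun n hn ↦ ?_
  obtain ⟨hn0, hlog⟩ := hT n hn
  set A := {x ∈ S.sigma Q | x.1 * x.2 = n} with hA
  have hAx : ∀ x ∈ A, x.2.Prime ∧ w ≤ Real.log x.2 ∧ x.1 * x.2 = n := fun x hx ↦ by
    obtain ⟨h1, h2⟩ := mem_filter.1 hx
    obtain ⟨h3, h4⟩ := mem_sigma.1 h1
    obtain ⟨h5, h6, -⟩ := hQ _ h3 _ h4
    exact ⟨h5, h6, h2⟩
  have hinj : Set.InjOn (fun x : (_ : ℕ) × ℕ ↦ x.2) A := by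
    rintro ⟨a, p⟩ hx ⟨b, q⟩ hy h
    obtain ⟨hp, -, h1⟩ := hAx _ hx
    obtain ⟨-, -, h2⟩ := hAx _ hy
    simp only at h h1 h2 hp
    subst h
    rw [Nat.eq_of_mul_eq_mul_right hp.pos (h1.trans h2.symm)]
  set I : Finset ℕ := A.image (fun x ↦ x.2) with hI
  have hsub : I ⊆ n.primeFactors := by
    intro p hp
    obtain ⟨x, hx, rfl⟩ := mem_image.1 hp
    obtain ⟨h1, -, h2⟩ := hAx x hx
    exact Nat.mem_primeFactors.2 ⟨h1, h2 ▸ dvd_mul_left _ _, hn0⟩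
  have hcard : (A.card : ℝ) ≤ k := by
    have h1 : (A.card : ℝ) * w ≤ ∑ p ∈ I, Real.log p := by
      rw [← card_image_of_injOn hinj, ← nsmul_eq_mul]
      refine card_nsmul_le_sum _ _ _ fun p hp ↦ ?_
      obtain ⟨x, hx, rfl⟩ := mem_image.1 hp
      exact (hAx x hx).2.1
    have h2 : ∑ p ∈ I, Real.log p ≤ ∑ p ∈ n.primeFactors, Real.log p :=
      sum_le_sum_of_subset_of_nonneg hsub fun p _ _ ↦ Real.log_natCast_nonneg p
    have h3 : ∑ p ∈ n.primeFactors, Real.log p ≤ Real.log n := by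
      rw [← Real.log_prod fun p hp ↦ by
        have := (Nat.prime_of_mem_primeFactors hp).pos
        positivity, ← Nat.cast_prod]
      exact Real.log_le_log (by exact_mod_cast Finset.prod_pos fun p hp ↦
        (Nat.prime_of_mem_primeFactors hp).pos)
        (by exact_mod_cast Nat.le_of_dvd (Nat.pos_of_ne_zero hn0) (Nat.prod_primeFactors_dvd n))
    exact le_of_mul_le_mul_right (by linarith) hw
  calc ∑ x ∈ A, F (x.1 * x.2) = ∑ x ∈ A, F n := sum_congr rfl fun x hx ↦ by rw [(hAx x hx).2.2]
    _ = A.card * F n := by rw [sum_const, nsmul_eq_mul]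
    _ ≤ _ := mul_le_mul_of_nonneg_right hcard (hF n)

/-- The sum of the reciprocals of the `t`-gap-dense integers whose logarithm lies in `(a, b]`. -/
noncomputable def gapDenseSum (t : ℕ) (a b : ℝ) : ℝ := ∑ m ∈ gapDenseWindow t a b, (m : ℝ)⁻¹

theorem gapDenseSum_nonneg (t : ℕ) (a b : ℝ) : 0 ≤ gapDenseSum t a b :=
  Finset.sum_nonneg fun _ _ ↦ by positivity

theorem gapDenseSum_mul_le {t k : ℕ} (ht : 1 ≤ t) {a b c d : ℝ} (hc : 1 ≤ c) (hda : d ≤ a)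
    (hk : b + d ≤ k * c) :
    gapDenseSum t a b * ∑ p ∈ primesIoc (Real.exp c) (Real.exp d), (p : ℝ)⁻¹ ≤
      k * gapDenseSum t (a + c) (b + d) := by
  rw [gapDenseSum, Finset.sum_mul_sum]
  simp_rw [← mul_inv, ← Nat.cast_mul]
  refine sum_mul_prime_le (S := gapDenseWindow t a b)
    (Q := fun _ ↦ primesIoc (Real.exp c) (Real.exp d)) (F := fun n ↦ (n : ℝ)⁻¹) (w := c)
    (by linarith) (fun n ↦ by positivity) (fun m hm p hp ↦ ?_) fun n hn ↦ ?_
  · obtain ⟨hm, ham, hmb⟩ := mem_gapDenseWindow.1 hm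
    obtain ⟨hp, hcp, hpd⟩ := (mem_primesIoc (Real.exp_pos c).le).1 hp
    have hm0 : (0 : ℝ) < m := by exact_mod_cast hm.pos
    have hp0 : (0 : ℝ) < p := by exact_mod_cast hp.pos
    have hcp' : c < Real.log p := (Real.lt_log_iff_exp_lt hp0).2 hcp
    have hpd' : Real.log p ≤ d := (Real.log_le_iff_le_exp hp0).2 hpd
    have h2p : 2 < p := by
      have := Real.add_one_le_exp c
      exact_mod_cast (by linarith : (2 : ℝ) < p)
    have hpm : p ≤ m := by
      have : Real.log p ≤ Real.log m := by linarith
      exact_mod_cast (Real.log_le_log_iff hp0 hm0).1 this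
    refine ⟨hp, hcp'.le, mem_gapDenseWindow.2 ⟨hm.mul_prime hp h2p (by nlinarith), ?_⟩⟩
    rw [Nat.cast_mul, Real.log_mul hm0.ne' hp0.ne']
    constructor <;> linarith
  · obtain ⟨hn, -, hnb⟩ := mem_gapDenseWindow.1 hn
    exact ⟨hn.pos.ne', by linarith⟩

theorem exists_gapDenseSum_le_doubled : ∃ s₀ : ℝ, 1 ≤ s₀ ∧ ∀ t : ℕ, 1 ≤ t → ∀ s : ℝ, s₀ ≤ s →
    gapDenseSum t s (2 * s) ≤ 1024 * gapDenseSum t (2 * s) (2 * (2 * s)) := by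
  obtain ⟨C, hC, h⟩ := exists_le_sum_primesIoc_inv
  refine ⟨2 + 4 * C, by linarith, fun t ht s hs ↦ ?_⟩
  have hs0 : 0 < s := by linarith
  have hP : 1 / 4 ≤ ∑ p ∈ primesIoc (Real.exp (s / 2)) (Real.exp s), (p : ℝ)⁻¹ := by
    refine le_trans ?_ (h (s / 2) s (by linarith) (by linarith))
    rw [le_div_iff₀ hs0]
    linarith
  have h1 := gapDenseSum_mul_le (t := t) (k := 8) (a := s) (b := 2 * s) (c := s / 2) (d := s) ht
    (by linarith) le_rfl (by push_cast; linarith)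
  have h2 := gapDenseSum_mul_le (t := t) (k := 8) (a := s + s / 2) (b := 2 * s + s) (c := s / 2)
    (d := s) ht (by linarith) (by linarith) (by push_cast; linarith)
  rw [show s + s / 2 + s / 2 = 2 * s by ring, show 2 * s + s + s = 2 * (2 * s) by ring] at h2
  have h3 := mul_le_mul_of_nonneg_left hP (gapDenseSum_nonneg t s (2 * s))
  have h4 := mul_le_mul_of_nonneg_left hP (gapDenseSum_nonneg t (s + s / 2) (2 * s + s))
  push_cast at h1 h2
  linarith

theorem gapDenseSum_add (t : ℕ) {a b c : ℝ} (hab : a ≤ b) (hbc : b ≤ c) :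
    gapDenseSum t a b + gapDenseSum t b c = gapDenseSum t a c := by
  rw [gapDenseSum, gapDenseSum, gapDenseSum, ← Finset.sum_union]
  · congr 1
    ext m
    simp only [Finset.mem_union, mem_gapDenseWindow]
    constructor
    · rintro (⟨h1, h2, h3⟩ | ⟨h1, h2, h3⟩)
      · exact ⟨h1, h2, h3.trans hbc⟩
      · exact ⟨h1, hab.trans_lt h2, h3⟩
    · rintro ⟨h1, h2, h3⟩
      rcases le_or_gt (Real.log m) b with h | h
      · exact Or.inl ⟨h1, h2, h⟩
      · exact Or.inr ⟨h1, h, h3⟩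
  · rw [Finset.disjoint_left]
    intro m hm hm'
    exact (mem_gapDenseWindow.1 hm').2.1.not_ge (mem_gapDenseWindow.1 hm).2.2

theorem exists_le_gapDenseSum : ∃ t : ℕ, 3 ≤ t ∧ ∃ c s₀ : ℝ, 0 < c ∧ 1 ≤ s₀ ∧
    ∀ s : ℝ, s₀ ≤ s → c ≤ gapDenseSum t s (2 * s) := by
  obtain ⟨t, ht, ε, K, c, L₀, hε, hK, hc, hL₀, h⟩ := exists_window_sum_gapDense_inv
  obtain ⟨s₁, hs₁, hd⟩ := exists_gapDenseSum_le_doubled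
  have hind : ∀ j : ℕ, ∃ B : ℝ, 0 ≤ B ∧ ∀ a : ℝ, s₁ ≤ a →
      gapDenseSum t a (2 ^ j * a) ≤ B * gapDenseSum t (2 ^ j * a) (2 * (2 ^ j * a)) := by
    intro j
    induction j with
    | zero =>
      refine ⟨0, le_rfl, fun a _ ↦ ?_⟩
      rw [pow_zero, one_mul, zero_mul, gapDenseSum, Finset.sum_eq_zero]
      intro m hm
      obtain ⟨-, h1, h2⟩ := mem_gapDenseWindow.1 hm
      exact absurd h2 h1.not_ge
    | succ j ih =>
      obtain ⟨B, hB, hB'⟩ := ih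
      refine ⟨(B + 1) * 1024, by positivity, fun a ha ↦ ?_⟩
      have ha0 : 0 < a := by linarith
      have h1j : (1 : ℝ) ≤ 2 ^ j := one_le_pow₀ one_le_two
      have h2 := hd t (by omega) (2 ^ j * a) (by nlinarith)
      have h3 := hB' a ha
      rw [show (2 : ℝ) ^ (j + 1) * a = 2 * (2 ^ j * a) by ring,
        ← gapDenseSum_add t (a := a) (b := 2 ^ j * a) (by nlinarith) (by nlinarith)]
      calc _ ≤ (B + 1) * gapDenseSum t (2 ^ j * a) (2 * (2 ^ j * a)) := by linarith
        _ ≤ (B + 1) * (1024 * gapDenseSum t (2 * (2 ^ j * a)) (2 * (2 * (2 ^ j * a)))) := by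
          gcongr
        _ = _ := by ring
  obtain ⟨J, hJ⟩ := pow_unbounded_of_one_lt (K / ε) (one_lt_two : (1 : ℝ) < 2)
  obtain ⟨B, hB, hB'⟩ := hind J
  refine ⟨t, ht, c / (B + 1), 2 ^ J * (1 + s₁ + ε * L₀), by positivity, ?_, fun s hs ↦ ?_⟩
  · have h1j : (1 : ℝ) ≤ 2 ^ J := one_le_pow₀ one_le_two
    have : 0 ≤ ε * L₀ := by positivity
    nlinarith
  set a := s / 2 ^ J with ha
  have hs' : s = 2 ^ J * a := by rw [ha]; field_simp
  have ha1 : 1 + s₁ + ε * L₀ ≤ a := by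
    rw [ha, le_div_iff₀ (by positivity)]
    linarith
  have hεL : 0 ≤ ε * L₀ := by positivity
  obtain ⟨S, hS, hcS⟩ := h (a / ε) (by rw [le_div_iff₀ hε]; linarith)
  have h1 : ∑ m ∈ S, (m : ℝ)⁻¹ ≤ gapDenseSum t a (2 ^ J * a) := by
    refine Finset.sum_le_sum_of_subset_of_nonneg (fun m hm ↦ ?_) fun _ _ _ ↦ by positivity
    obtain ⟨h1, h2, h3⟩ := hS m hm
    rw [mul_div_cancel₀ _ hε.ne'] at h2
    refine mem_gapDenseWindow.2 ⟨h1, h2, h3.trans ?_⟩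
    rw [mul_div_assoc', div_le_iff₀ hε]
    rw [div_lt_iff₀ hε] at hJ
    nlinarith
  have h2 := hB' a (by linarith)
  rw [← hs'] at h1 h2
  have h3 := gapDenseSum_nonneg t s (2 * s)
  rw [div_le_iff₀ (by positivity)]
  nlinarith

theorem exists_le_card_gapDenseWindow : ∃ t : ℕ, 3 ≤ t ∧ ∃ c x₀ : ℝ, 0 < c ∧ 2 ≤ x₀ ∧
    ∀ x : ℝ, x₀ ≤ x → c * x / Real.log x ≤ (gapDenseWindow t (-1) (Real.log x)).card := by
  obtain ⟨t, ht, c, s₀, hc, hs₀, hlow⟩ := exists_le_gapDenseSum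
  obtain ⟨C, hC, hmert⟩ := exists_le_sum_primesIoc_inv
  obtain ⟨y₀, hy₀, hpi⟩ := exists_le_card_primesIoc
  set s₁ := s₀ + 2 * C + y₀ + 8 with hs₁
  refine ⟨t, ht, c / 2000, Real.exp (22 * s₁), by positivity, ?_, fun x hx ↦ ?_⟩
  · have := Real.add_one_le_exp (22 * s₁)
    linarith
  have hx0 : 0 < x := (Real.exp_pos _).trans_le hx
  obtain ⟨s, rfl⟩ : ∃ s, Real.exp (22 * s) = x :=
    ⟨Real.log x / 22, by rw [mul_div_cancel₀ _ (by norm_num), Real.exp_log hx0]⟩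
  have hs : s₁ ≤ s := by
    have := Real.exp_le_exp.1 hx
    linarith
  rw [Real.log_exp]
  have hs0 : 0 < s := by linarith
  have h1 := hlow (6 * s) (by linarith)
  have h2 : 1 / 12 ≤ ∑ p ∈ primesIoc (Real.exp (5 * s)) (Real.exp (6 * s)), (p : ℝ)⁻¹ := by
    refine le_trans ?_ (hmert (5 * s) (6 * s) (by linarith) (by linarith))
    rw [le_div_iff₀ (by linarith)]
    linarith
  have h3 := gapDenseSum_mul_le (t := t) (k := 4) (a := 6 * s) (b := 2 * (6 * s)) (c := 5 * s)
    (d := 6 * s) (by omega) (by linarith) (by linarith) (by push_cast; linarith)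
  rw [show 6 * s + 5 * s = 11 * s by ring, show 2 * (6 * s) + 6 * s = 18 * s by ring] at h3
  have h4 : c / 48 ≤ gapDenseSum t (11 * s) (18 * s) := by
    have := mul_le_mul h1 h2 (by norm_num) (gapDenseSum_nonneg _ _ _)
    push_cast at h3
    linarith
  have h5 := sum_mul_prime_le (S := gapDenseWindow t (11 * s) (18 * s))
    (T := gapDenseWindow t (-1) (22 * s))
    (Q := fun n ↦ primesIoc (Real.exp (2 * s)) (Real.exp (22 * s) / n)) (F := fun _ ↦ 1)
    (w := 2 * s) (k := 11) (by linarith) (fun _ ↦ zero_le_one) (fun n hn q hq ↦ ?_) fun n hn ↦ ?_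
  rotate_left
  · obtain ⟨hn, han, hnb⟩ := mem_gapDenseWindow.1 hn
    obtain ⟨hq, hcq, hqd⟩ := (mem_primesIoc (Real.exp_pos _).le).1 hq
    have hn0 : (0 : ℝ) < n := by exact_mod_cast hn.pos
    have hq0 : (0 : ℝ) < q := by exact_mod_cast hq.pos
    rw [le_div_iff₀ hn0, ← Real.log_le_iff_le_exp (by positivity),
      Real.log_mul hq0.ne' hn0.ne'] at hqd
    have h2q : 2 < q := by
      have := Real.add_one_le_exp (2 * s)
      exact_mod_cast (by linarith : (2 : ℝ) < q)
    have hqn : q ≤ n := by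
      have : Real.log q ≤ Real.log n := by linarith
      exact_mod_cast (Real.log_le_log_iff hq0 hn0).1 this
    refine ⟨hq, ((Real.lt_log_iff_exp_lt hq0).2 hcq).le,
      mem_gapDenseWindow.2 ⟨hn.mul_prime hq h2q (by nlinarith), ?_, ?_⟩⟩
    · linarith [Real.log_natCast_nonneg (n * q)]
    · rw [Nat.cast_mul, Real.log_mul hn0.ne' hq0.ne']
      linarith
  · obtain ⟨hn, -, hnb⟩ := mem_gapDenseWindow.1 hn
    exact ⟨hn.pos.ne', by push_cast; linarith⟩
  simp only [Finset.sum_const, nsmul_eq_mul, mul_one] at h5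
  have h6 : Real.exp (22 * s) / (44 * s) * gapDenseSum t (11 * s) (18 * s) ≤
      ∑ n ∈ gapDenseWindow t (11 * s) (18 * s),
        ((primesIoc (Real.exp (2 * s)) (Real.exp (22 * s) / n)).card : ℝ) := by
    rw [gapDenseSum, Finset.mul_sum]
    refine Finset.sum_le_sum fun n hn ↦ ?_
    obtain ⟨hn, han, hnb⟩ := mem_gapDenseWindow.1 hn
    have hn0 : (0 : ℝ) < n := by exact_mod_cast hn.pos
    have hz : Real.exp (4 * s) ≤ Real.exp (22 * s) / n := by
      rw [le_div_iff₀ hn0]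
      calc _ ≤ Real.exp (4 * s) * Real.exp (18 * s) := by
            gcongr
            exact (Real.log_le_iff_le_exp hn0).1 hnb
        _ = _ := by rw [← Real.exp_add]; ring_nf
    have hz2 : Real.exp (22 * s) / n ≤ Real.exp (11 * s) := by
      rw [div_le_iff₀ hn0]
      calc _ = Real.exp (11 * s) * Real.exp (11 * s) := by rw [← Real.exp_add]; ring_nf
        _ ≤ _ := by
            gcongr
            exact ((Real.lt_log_iff_exp_lt hn0).1 han).le
    have he := Real.add_one_le_exp (2 * s)
    have he4 := Real.add_one_le_exp (4 * s)
    have h7 := hpi (Real.exp (2 * s)) (Real.exp (22 * s) / n) (Real.exp_pos _).le (by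
      rw [le_div_iff₀ (by norm_num)]
      refine le_trans ?_ hz
      rw [show 4 * s = 2 * s + 2 * s by ring, Real.exp_add]
      gcongr
      linarith) (by linarith)
    have h8 : Real.log (Real.exp (22 * s) / n) ≤ 11 * s :=
      (Real.log_le_iff_le_exp (by positivity)).2 hz2
    have h9 : Real.exp (22 * s) / n / 4 ≤
        ((primesIoc (Real.exp (2 * s)) (Real.exp (22 * s) / n)).card : ℝ) * (11 * s) :=
      h7.trans (by gcongr)
    rw [div_mul_eq_mul_div, ← div_eq_mul_inv, div_le_iff₀ (by positivity)]
    linarith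
  have h7 : Real.exp (22 * s) / (44 * s) * (c / 48) ≤
      Real.exp (22 * s) / (44 * s) * gapDenseSum t (11 * s) (18 * s) := by gcongr
  have h8 : Real.exp (22 * s) / (44 * s) * (c / 48) = c * Real.exp (22 * s) / s / 2112 := by
    field_simp
    norm_num
  have h9 : c / 2000 * Real.exp (22 * s) / (22 * s) = c * Real.exp (22 * s) / s / 44000 := by
    field_simp
    norm_num
  have h10 : 0 ≤ c * Real.exp (22 * s) / s := by positivity
  rw [h9]
  push_cast at h5
  linarith

/-- One of `a` and `b` divides the other. -/
def DvdComparable (a b : ℕ) : Prop := a ∣ b ∨ b ∣ a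

/-- A divisibility chain of distinct `y`-smooth positive integers up to `max X 2` that starts at `1`
and avoids the multiples of `8`, the number `4`, and four times each prime. -/
structure IsSmoothChain (X y : ℕ) (l : List ℕ) : Prop where
  isChain : l.IsChain DvdComparable
  head : l.head? = some 1
  nodup : l.Nodup
  pos : ∀ e ∈ l, 0 < e
  le : ∀ e ∈ l, e ≤ max X 2
  prime_le : ∀ e ∈ l, ∀ q, q.Prime → 2 < q → q ∣ e → q ≤ y
  not_dvd : ∀ e ∈ l, ¬ 8 ∣ e
  four_mul : ∀ j, 4 * j ∈ l → j ≠ 1 ∧ ¬ j.Prime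

/-- `l` contains all `y`-smooth `t`-gap-dense integers up to `X / (4 * t)`. -/
def CoversGapDense (t X y : ℕ) (l : List ℕ) : Prop :=
  ∀ m, IsGapDense t m → (∀ q, q.Prime → q ∣ m → q ≤ y) → 4 * t * m ≤ X → m ∈ l

theorem DvdComparable.mul_left {a b : ℕ} (p : ℕ) (h : DvdComparable a b) :
    DvdComparable (p * a) (p * b) :=
  h.imp (mul_dvd_mul_left p) (mul_dvd_mul_left p)

theorem List.IsChain.map_mul_left {l : List ℕ} (p : ℕ) (h : l.IsChain DvdComparable) :
    (l.map (p * ·)).IsChain DvdComparable := by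
  rw [List.isChain_map]
  exact h.imp fun _ _ h ↦ h.mul_left p

theorem IsSmoothChain.mono {X y z : ℕ} {l : List ℕ} (h : IsSmoothChain X y l) (hyz : y ≤ z) :
    IsSmoothChain X z l :=
  { h with prime_le := fun e he q hq h2 hqe ↦ (h.prime_le e he q hq h2 hqe).trans hyz }

theorem isSmoothChain_singleton_one (X y : ℕ) : IsSmoothChain X y [1] where
  isChain := by simp
  head := rfl
  nodup := by simp
  pos := by simp
  le := by simp
  prime_le := by simp +contextual [Nat.Prime.ne_one]
  not_dvd := by simp
  four_mul := fun j hj ↦ by simp at hj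

theorem IsSmoothChain.append_two {X y a : ℕ} {l : List ℕ} (h : IsSmoothChain X y l)
    (hlast : l.getLast? = some a) (ha : DvdComparable a 2) (h2 : 2 ∉ l) :
    IsSmoothChain X y (l ++ [2]) where
  isChain := by
    rw [List.isChain_append]
    refine ⟨h.isChain, by simp, fun x hx z hz ↦ ?_⟩
    simp_all
  head := by simp [h.head]
  nodup := by
    rw [List.nodup_append]
    refine ⟨h.nodup, by simp, ?_⟩
    rintro x hx z hz rfl
    simp_all
  pos := by simpa [or_imp, forall_and] using h.pos
  le := by
    intro e he
    rcases List.mem_append.1 he with he | he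
    · exact h.le e he
    · simp_all
  prime_le := by
    intro e he q hq hq2 hqe
    rcases List.mem_append.1 he with he | he
    · exact h.prime_le e he q hq hq2 hqe
    · simp only [List.mem_singleton] at he
      subst he
      exact absurd (Nat.le_of_dvd two_pos hqe) (by omega)
  not_dvd := by
    intro e he
    rcases List.mem_append.1 he with he | he
    · exact h.not_dvd e he
    · simp_all
  four_mul := by
    intro j hj
    rcases List.mem_append.1 hj with hj | hj
    · exact h.four_mul j hj
    · simp only [List.mem_singleton] at hj
      omega

theorem Nat.Prime.not_dvd_two_pow_of_two_lt {p : ℕ} (hp : p.Prime) (h2 : 2 < p) (k : ℕ) :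
    ¬ p ∣ 2 ^ k := fun h ↦
  absurd ((Nat.prime_dvd_prime_iff_eq hp Nat.prime_two).1 (hp.dvd_of_dvd_pow h)) (by omega)

theorem Nat.Prime.coprime_two_pow_of_two_lt {p : ℕ} (hp : p.Prime) (h2 : 2 < p) (k : ℕ) :
    (2 ^ k).Coprime p :=
  ((hp.coprime_iff_not_dvd).2 (hp.not_dvd_two_pow_of_two_lt h2 k)).symm

theorem IsSmoothChain.append_mul {X y p : ℕ} {l l' c : List ℕ} (hp : p.Prime) (hp2 : 2 < p)
    (hyp : y < p) (hpX : 4 * p ^ 2 ≤ X) (h : IsSmoothChain X y l) (h' : IsSmoothChain (X / p) p l')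
    (hc : (l.getLast? = some 1 ∧ c = []) ∨
      ∃ q, q.Prime ∧ 2 < q ∧ q ≤ y ∧ l.getLast? = some (2 * q) ∧ c = [4 * q * p]) :
    IsSmoothChain X p (l ++ (c ++ l'.map (p * ·))) := by
  have hc' : ∀ e ∈ c, ∃ q, q.Prime ∧ 2 < q ∧ q ≤ y ∧ e = 4 * q * p := by
    rcases hc with ⟨-, rfl⟩ | ⟨q, hq, hq2, hqy, -, rfl⟩
    · simp
    · intro e he
      exact ⟨q, hq, hq2, hqy, List.mem_singleton.1 he⟩
  have hhead : (l'.map (p * ·)).head? = some p := by simp [h'.head]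
  have hXp : p * (X / p) ≤ X := Nat.mul_div_le X p
  have hcop8 := hp.coprime_two_pow_of_two_lt hp2 3
  have hcop4 := hp.coprime_two_pow_of_two_lt hp2 2
  norm_num at hcop8 hcop4
  have hpl : ∀ e ∈ l, ¬ p ∣ e := fun e he hpe ↦
    absurd (h.prime_le e he p hp hp2 hpe) (by omega)
  have hpc : ∀ e ∈ c ++ l'.map (p * ·), p ∣ e := by
    intro e he
    rcases List.mem_append.1 he with he | he
    · obtain ⟨q, -, -, -, rfl⟩ := hc' e he
      exact dvd_mul_left _ _
    · obtain ⟨e', -, rfl⟩ := List.mem_map.1 he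
      exact dvd_mul_right _ _
  refine ⟨?_, by simp [h.head], ?_, ?_, ?_, ?_, ?_, ?_⟩
  · rcases hc with ⟨hl, rfl⟩ | ⟨q, hq, hq2, hqy, hl, rfl⟩
    · rw [List.nil_append, List.isChain_append]
      refine ⟨h.isChain, h'.isChain.map_mul_left p, fun x hx z hz ↦ ?_⟩
      rw [hl] at hx
      rw [hhead] at hz
      cases hx
      cases hz
      exact Or.inl (one_dvd _)
    · rw [List.isChain_append, List.isChain_append]
      refine ⟨h.isChain, ⟨by simp, h'.isChain.map_mul_left p, fun x hx z hz ↦ ?_⟩,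
        fun x hx z hz ↦ ?_⟩
      · rw [hhead] at hz
        cases hx
        cases hz
        exact Or.inr (dvd_mul_left _ _)
      · rw [hl] at hx
        cases hx
        cases hz
        exact Or.inl ⟨2 * p, by ring⟩
  · rw [List.nodup_append, List.nodup_append]
    refine ⟨h.nodup, ⟨?_, h'.nodup.map fun a b hab ↦ Nat.eq_of_mul_eq_mul_left hp.pos hab, ?_⟩, ?_⟩
    · rcases hc with ⟨-, rfl⟩ | ⟨q, -, -, -, -, rfl⟩ <;> simp
    · rintro x hx z hz rfl
      obtain ⟨q, hq, -, -, rfl⟩ := hc' x hx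
      obtain ⟨e, he, h1⟩ := List.mem_map.1 hz
      have h2 : e = 4 * q := Nat.eq_of_mul_eq_mul_left hp.pos (by simpa [mul_comm] using h1)
      exact (h'.four_mul q (h2 ▸ he)).2 hq
    · rintro x hx z hz rfl
      exact hpl x hx (hpc x hz)
  · intro e he
    rcases List.mem_append.1 he with he | he
    · exact h.pos e he
    rcases List.mem_append.1 he with he | he
    · obtain ⟨q, hq, -, -, rfl⟩ := hc' e he
      have := hq.pos
      have := hp.pos
      positivity
    · obtain ⟨e, hel, rfl⟩ := List.mem_map.1 he
      exact Nat.mul_pos hp.pos (h'.pos e hel)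
  · intro e he
    rcases List.mem_append.1 he with he | he
    · exact h.le e he
    refine le_trans ?_ (le_max_left _ _)
    rcases List.mem_append.1 he with he | he
    · obtain ⟨q, -, -, hqy, rfl⟩ := hc' e he
      refine le_trans ?_ hpX
      rw [pow_two, ← mul_assoc]
      gcongr
      omega
    · obtain ⟨e, hel, rfl⟩ := List.mem_map.1 he
      rcases le_max_iff.1 (h'.le e hel) with h1 | h1
      · exact (Nat.mul_le_mul_left p h1).trans hXp
      · nlinarith
  · intro e he r hr hr2 hre
    rcases List.mem_append.1 he with he | he
    · exact (h.prime_le e he r hr hr2 hre).trans hyp.le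
    rcases List.mem_append.1 he with he | he
    · obtain ⟨q, hq, -, hqy, rfl⟩ := hc' e he
      rcases hr.dvd_mul.1 hre with h1 | h1
      · rcases hr.dvd_mul.1 h1 with h1 | h1
        · exact absurd h1 (hr.not_dvd_two_pow_of_two_lt hr2 2)
        · exact (Nat.le_of_dvd hq.pos h1).trans (by omega)
      · exact Nat.le_of_dvd hp.pos h1
    · obtain ⟨e, hel, rfl⟩ := List.mem_map.1 he
      rcases hr.dvd_mul.1 hre with h1 | h1
      · exact Nat.le_of_dvd hp.pos h1
      · exact h'.prime_le e hel r hr hr2 h1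
  · intro e he h8
    rcases List.mem_append.1 he with he | he
    · exact h.not_dvd e he h8
    rcases List.mem_append.1 he with he | he
    · obtain ⟨q, hq, hq2, hqy, rfl⟩ := hc' e he
      have h1 := hcop8.dvd_of_dvd_mul_right h8
      have h2 : 2 * 4 ∣ q * 4 := by simpa [mul_comm] using h1
      have h3 := (Nat.prime_dvd_prime_iff_eq Nat.prime_two hq).1
        (Nat.dvd_of_mul_dvd_mul_right (by norm_num) h2)
      omega
    · obtain ⟨e, hel, rfl⟩ := List.mem_map.1 he
      exact h'.not_dvd e hel (hcop8.dvd_of_dvd_mul_left h8)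
  · intro j hj
    rcases List.mem_append.1 hj with he | he
    · exact h.four_mul j he
    rcases List.mem_append.1 he with he | he
    · obtain ⟨q, hq, -, -, h1⟩ := hc' _ he
      have h2 : j = q * p := by linarith
      subst h2
      exact ⟨fun h ↦ hq.ne_one (Nat.eq_one_of_mul_eq_one_right h),
        Nat.not_prime_mul hq.ne_one hp.ne_one⟩
    · obtain ⟨e, hel, h1⟩ := List.mem_map.1 he
      have h2 : 4 ∣ e := hcop4.dvd_of_dvd_mul_left ⟨j, h1⟩
      obtain ⟨i, rfl⟩ := h2
      have h3 : j = p * i := by linarith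
      subst h3
      exact ⟨fun h ↦ hp.ne_one (Nat.eq_one_of_mul_eq_one_right h),
        Nat.not_prime_mul hp.ne_one (h'.four_mul i hel).1⟩

theorem IsGapDense.sq_le {t m p : ℕ} (hm : IsGapDense t m) (hp : p.Prime) (hpm : p ∣ m) :
    p ^ 2 ≤ t * m := by
  obtain ⟨d, hd, hdp, h⟩ := hm.2 p hp hpm
  have hcop : p.Coprime d := hp.coprime_iff_not_dvd.2 fun h ↦ (hdp p hp h).false
  have h1 : p * d ≤ m := Nat.le_of_dvd hm.pos (hcop.mul_dvd_of_dvd_of_dvd hpm hd)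
  calc p ^ 2 = p * p := pow_two p
    _ ≤ p * (t * d) := by gcongr
    _ = t * (p * d) := by ring
    _ ≤ t * m := by gcongr

theorem IsGapDense.of_mul_prime {t m p : ℕ} (hm : IsGapDense t (p * m)) (hp : p.Prime)
    (hle : ∀ q, q.Prime → q ∣ p * m → q ≤ p) : IsGapDense t m := by
  refine ⟨hm.1.of_dvd (dvd_mul_left m p), fun q hq hqm ↦ ?_⟩
  have hqpm : q ∣ p * m := hqm.mul_left p
  obtain ⟨d, hd, hdq, h⟩ := hm.2 q hq hqpm
  have hcop : p.Coprime d := hp.coprime_iff_not_dvd.2 fun h ↦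
    absurd (hdq p hp h) (hle q hq hqpm).not_gt
  exact ⟨d, hcop.symm.dvd_of_dvd_mul_left hd, hdq, h⟩

theorem coversGapDense_of_le_two {t X y : ℕ} (hy : y ≤ 2) : CoversGapDense t X y [1] := by
  intro m hm hmy _
  rw [List.mem_singleton]
  by_contra h
  have h1 := hmy _ (Nat.minFac_prime h) m.minFac_dvd
  have h2 := hm.1.2 _ (Nat.minFac_prime h) m.minFac_dvd
  omega

theorem CoversGapDense.succ {t X y : ℕ} {l : List ℕ} (h : CoversGapDense t X y l)
    (hy : (y + 1).Prime → X < 4 * (y + 1) ^ 2) : CoversGapDense t X (y + 1) l := by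
  intro m hm hmy hmX
  refine h m hm (fun q hq hqm ↦ ?_) hmX
  have h1 := hmy q hq hqm
  by_contra h2
  obtain rfl : q = y + 1 := by omega
  have h3 := hm.sq_le hq hqm
  have h4 := hy hq
  rw [mul_assoc] at hmX
  omega

theorem CoversGapDense.append_mul {t X y : ℕ} {l l' : List ℕ} (h : CoversGapDense t X y l)
    (hp : (y + 1).Prime) (h' : CoversGapDense t (X / (y + 1)) (y + 1) l') (c : List ℕ) :
    CoversGapDense t X (y + 1) (l ++ (c ++ l'.map ((y + 1) * ·))) := by
  intro m hm hmy hmX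
  by_cases hpm : y + 1 ∣ m
  · obtain ⟨n, rfl⟩ := hpm
    refine List.mem_append_right _ (List.mem_append_right _ (List.mem_map.2 ⟨n, ?_, rfl⟩))
    refine h' n (hm.of_mul_prime hp hmy) (fun q hq hqn ↦ hmy q hq (hqn.mul_left _)) ?_
    rw [Nat.le_div_iff_mul_le hp.pos]
    linarith
  · refine List.mem_append_left _ (h m hm (fun q hq hqm ↦ ?_) hmX)
    have h1 := hmy q hq hqm
    by_contra h2
    obtain rfl : q = y + 1 := by omega
    exact hpm hqm

theorem exists_isSmoothChain (t X y : ℕ) : ∃ l, IsSmoothChain X y l ∧ l.getLast? = some 2 ∧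
    CoversGapDense t X y l := by
  induction X using Nat.strong_induction_on generalizing y with
  | _ X ih =>
  obtain ⟨l, a, hl, hla, h2, ha, hcov⟩ : ∃ l a, IsSmoothChain X y l ∧ l.getLast? = some a ∧ 2 ∉ l ∧
      (a = 1 ∨ ∃ q, q.Prime ∧ 2 < q ∧ q ≤ y ∧ a = 2 * q) ∧ CoversGapDense t X y l := by
    induction y with
    | zero =>
      exact ⟨[1], 1, isSmoothChain_singleton_one X 0, rfl, by simp, Or.inl rfl,
        coversGapDense_of_le_two (by omega)⟩
    | succ y ihy =>
      obtain ⟨l, a, hl, hla, h2, ha, hcov⟩ := ihy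
      by_cases hy2 : y + 1 ≤ 2
      · exact ⟨[1], 1, isSmoothChain_singleton_one X _, rfl, by simp, Or.inl rfl,
          coversGapDense_of_le_two hy2⟩
      by_cases hp : (y + 1).Prime ∧ 4 * (y + 1) ^ 2 ≤ X
      swap
      · refine ⟨l, a, hl.mono (by omega), hla, h2, ?_, hcov.succ (by grind)⟩
        exact ha.imp_right fun ⟨q, hq, hq2, hqy, h⟩ ↦ ⟨q, hq, hq2, by omega, h⟩
      obtain ⟨hp, hpX⟩ := hp
      obtain ⟨l', hl', hl'2, hcov'⟩ := ih (X / (y + 1))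
        (Nat.div_lt_self (lt_of_lt_of_le (by positivity) hpX) (by omega)) (y + 1)
      obtain ⟨c, hc⟩ : ∃ c : List ℕ, (l.getLast? = some 1 ∧ c = []) ∨
          ∃ q, q.Prime ∧ 2 < q ∧ q ≤ y ∧ l.getLast? = some (2 * q) ∧ c = [4 * q * (y + 1)] := by
        rcases ha with rfl | ⟨q, hq, hq2, hqy, rfl⟩
        · exact ⟨[], Or.inl ⟨hla, rfl⟩⟩
        · exact ⟨_, Or.inr ⟨q, hq, hq2, hqy, hla, rfl⟩⟩
      refine ⟨_, 2 * (y + 1), hl.append_mul hp (by omega) (by omega) hpX hl' hc, ?_, ?_,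
        Or.inr ⟨y + 1, hp, by omega, le_rfl, rfl⟩, hcov.append_mul hp hcov' c⟩
      · simp [List.getLast?_append, List.getLast?_map, hl'2, mul_comm]
      · intro hmem
        rcases List.mem_append.1 hmem with h | h
        · exact h2 h
        suffices y + 1 ∣ 2 from absurd (Nat.le_of_dvd two_pos this) hy2
        rcases List.mem_append.1 h with h | h
        · rcases hc with ⟨-, rfl⟩ | ⟨q, -, -, -, -, rfl⟩
          · simp at h
          · rw [List.mem_singleton] at h
            exact h ▸ dvd_mul_left _ _
        · obtain ⟨e, -, h⟩ := List.mem_map.1 h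
          exact ⟨e, h.symm⟩
  refine ⟨l ++ [2], hl.append_two hla ?_ h2, by simp, fun m hm hmy hmX ↦
    List.mem_append_left _ (hcov m hm hmy hmX)⟩
  rcases ha with rfl | ⟨q, -, -, -, rfl⟩
  · exact Or.inl (one_dvd 2)
  · exact Or.inr (dvd_mul_right 2 q)

theorem exists_bijective_of_isPrefix_succ {R : ℕ → ℕ → Prop} {L : ℕ → List ℕ}
    (hpre : ∀ i, L i <+: L (i + 1)) (hlen : ∀ i, i < (L i).length) (hnodup : ∀ i, (L i).Nodup)
    (hchain : ∀ i, (L i).IsChain R) (hpos : ∀ i, ∀ e ∈ L i, 0 < e)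
    (hmem : ∀ n, ∃ i, n + 1 ∈ L i) :
    ∃ f : ℕ+ → ℕ+, Function.Bijective f ∧ (∀ n, R (f n) (f (n + 1))) ∧
      ∀ (n : ℕ+) i, (n : ℕ) ≤ (L i).length → (f n : ℕ) ∈ L i := by
  have hmono : ∀ i j, i ≤ j → L i <+: L j := fun i j h ↦
    Nat.le_induction (List.prefix_refl _) (fun j _ ih ↦ ih.trans (hpre j)) j h
  have hget : ∀ i k (h : k < (L i).length), (L i)[k] = (L k)[k]'(hlen k) := by
    intro i k h
    rcases le_total i k with hik | hik
    · exact (hmono i k hik).getElem h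
    · exact ((hmono k i hik).getElem (hlen k)).symm
  let f : ℕ+ → ℕ+ := fun n ↦
    ⟨(L n.natPred)[n.natPred]'(hlen _), hpos _ _ (List.getElem_mem _)⟩
  have hf : ∀ (n : ℕ+) i (h : n.natPred < (L i).length), (f n : ℕ) = (L i)[n.natPred] :=
    fun n i h ↦ (hget i _ h).symm
  refine ⟨f, ⟨fun a b hab ↦ ?_, fun n ↦ ?_⟩, fun n ↦ ?_, fun n i hn ↦ ?_⟩
  · have ha : a.natPred < (L (max a.natPred b.natPred)).length :=
      (le_max_left _ _).trans_lt (hlen _)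
    have hb : b.natPred < (L (max a.natPred b.natPred)).length :=
      (le_max_right _ _).trans_lt (hlen _)
    have h : (f a : ℕ) = f b := by rw [hab]
    rw [hf a _ ha, hf b _ hb] at h
    exact PNat.natPred_injective ((hnodup _).getElem_inj_iff.1 h)
  · obtain ⟨i, hi⟩ := hmem n.natPred
    obtain ⟨k, hk, h⟩ := List.getElem_of_mem hi
    refine ⟨k.succPNat, PNat.eq ?_⟩
    have hk' : k.succPNat.natPred < (L i).length := by simpa using hk
    rw [hf _ i hk']
    simpa using h
  · have h0 : n.natPred + 1 < (L (n.natPred + 1)).length := hlen _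
    have h1 : (n + 1).natPred = n.natPred + 1 := by
      simp [PNat.natPred]
      have := n.pos
      omega
    have h2 : (f (n + 1) : ℕ) = (L (n.natPred + 1))[n.natPred + 1] := by
      rw [hf (n + 1) (n.natPred + 1) (h1 ▸ h0)]
      simp only [h1]
    rw [h2, hf n (n.natPred + 1) (by omega)]
    exact List.isChain_iff_getElem.1 (hchain _) _ h0
  · have h1 : n.natPred < (L i).length := by
      have := n.natPred_add_one
      omega
    rw [hf n i h1]
    exact List.getElem_mem h1

/-- The `i`-th odd prime. -/
noncomputable def oddPrime (i : ℕ) : ℕ := Nat.nth Nat.Prime (i + 1)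

theorem oddPrime_prime (i : ℕ) : (oddPrime i).Prime := Nat.prime_nth_prime _

theorem oddPrime_strictMono : StrictMono oddPrime := fun _ _ h ↦
  Nat.nth_strictMono Nat.infinite_setOfPred_prime (by omega)

theorem two_lt_oddPrime (i : ℕ) : 2 < oddPrime i := by
  rw [← Nat.nth_prime_zero_eq_two]
  exact Nat.nth_strictMono Nat.infinite_setOfPred_prime (by omega)

theorem lt_oddPrime (i : ℕ) : i < oddPrime i := by
  induction i with
  | zero => exact (oddPrime_prime 0).pos
  | succ i ih => exact Nat.lt_of_le_of_lt ih (oddPrime_strictMono i.lt_succ_self)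

theorem exists_oddPrime_eq {p : ℕ} (hp : p.Prime) (h2 : 2 < p) : ∃ i, oddPrime i = p := by
  have h := Nat.nth_count hp
  have h0 : Nat.count Nat.Prime p ≠ 0 := by
    intro h0
    rw [h0, Nat.nth_prime_zero_eq_two] at h
    omega
  refine ⟨Nat.count Nat.Prime p - 1, ?_⟩
  rw [oddPrime, Nat.sub_add_cancel (Nat.pos_of_ne_zero h0), h]

theorem oddPrime_succ_le (i : ℕ) : oddPrime (i + 1) ≤ 2 * oddPrime i := by
  obtain ⟨p, hp, h1, h2⟩ := Nat.exists_prime_lt_and_le_two_mul _ (oddPrime_prime i).ne_zero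
  obtain ⟨j, rfl⟩ := exists_oddPrime_eq hp ((two_lt_oddPrime i).trans h1)
  exact (oddPrime_strictMono.monotone (oddPrime_strictMono.lt_iff_lt.1 h1)).trans h2

/-- `n` is `oddPrime i` times a member of `T i`, for some `i`. -/
def InBlocks (T : ℕ → List ℕ) (n : ℕ) : Prop := ∃ i, ∃ e ∈ T i, oddPrime i * e = n

open Classical in
/-- A list from the multiples `oddPrime i * 2` to `oddPrime (i + 1)`, exclusive of both ends, that
visits `i + 1` if this is in no block and not in `l`. -/
noncomputable def connector (T : ℕ → List ℕ) (l : List ℕ) (i : ℕ) : List ℕ :=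
  if InBlocks T (i + 1) ∨ i + 1 ∈ l then [16 * (oddPrime i * oddPrime (i + 1))]
  else [32 * (oddPrime i * (i + 1)), i + 1, 32 * (oddPrime (i + 1) * (i + 1))]

/-- The concatenation of the blocks `oddPrime j * T j` for `j ≤ i`, with connectors between them. -/
noncomputable def chainPrefix (T : ℕ → List ℕ) : ℕ → List ℕ
  | 0 => (T 0).map (oddPrime 0 * ·)
  | i + 1 => chainPrefix T i ++
      (connector T (chainPrefix T i) i ++ (T (i + 1)).map (oddPrime (i + 1) * ·))

/-- The possible members of `chainPrefix T i`. -/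
def IsPrefixMember (T : ℕ → List ℕ) (i e : ℕ) : Prop :=
  (∃ j ≤ i, ∃ d ∈ T j, oddPrime j * d = e) ∨ ¬ InBlocks T e ∧ (e ≤ i ∨
    32 ∣ e ∧ e ≤ 32 * (oddPrime i * i) ∨ ¬ 32 ∣ e ∧ e < 16 * (oddPrime i * oddPrime (i + 1)))

theorem not_eight_dvd_of_inBlocks {T : ℕ → List ℕ}
    (hT : ∀ i, IsSmoothChain (oddPrime i) (oddPrime i) (T i)) {n : ℕ} (h : InBlocks T n) :
    ¬ 8 ∣ n := by
  obtain ⟨i, e, he, rfl⟩ := h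
  intro h8
  have h1 := (oddPrime_prime i).coprime_two_pow_of_two_lt (two_lt_oddPrime i) 3
  norm_num at h1
  exact (hT i).not_dvd e he (h1.dvd_of_dvd_mul_left h8)

theorem oddPrime_mul_injOn {T : ℕ → List ℕ}
    (hT : ∀ i, IsSmoothChain (oddPrime i) (oddPrime i) (T i)) {i j d e : ℕ} (hd : d ∈ T i)
    (he : e ∈ T j) (h : oddPrime i * d = oddPrime j * e) : i = j := by
  have key : ∀ i j d e, d ∈ T i → oddPrime i * d = oddPrime j * e → ¬ i < j := by
    intro i j d e hd h hij
    have hlt := oddPrime_strictMono hij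
    rcases (oddPrime_prime j).dvd_mul.1 (h.symm ▸ dvd_mul_right _ _ :
      oddPrime j ∣ oddPrime i * d) with h1 | h1
    · exact absurd (Nat.le_of_dvd (oddPrime_prime i).pos h1) (by omega)
    · exact absurd ((hT i).prime_le d hd _ (oddPrime_prime j) (two_lt_oddPrime j) h1) (by omega)
  have h1 := key i j d e hd h
  have h2 := key j i e d he h.symm
  omega

theorem not_dvd_sixteen_mul (i : ℕ) : ¬ 32 ∣ 16 * (oddPrime i * oddPrime (i + 1)) := by
  intro h
  have h2 : 2 ∣ oddPrime i * oddPrime (i + 1) := by omega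
  have key (j : ℕ) : ¬ 2 ∣ oddPrime j := fun h ↦ (two_lt_oddPrime j).ne
    ((Nat.prime_dvd_prime_iff_eq Nat.prime_two (oddPrime_prime j)).1 h)
  exact (Nat.prime_two.dvd_mul.1 h2).elim (key i) (key (i + 1))

theorem isPrefixMember_of_mem_chainPrefix {T : ℕ → List ℕ}
    (hT : ∀ i, IsSmoothChain (oddPrime i) (oddPrime i) (T i)) (i : ℕ) :
    ∀ e ∈ chainPrefix T i, IsPrefixMember T i e := by
  induction i with
  | zero =>
    intro e he
    obtain ⟨d, hd, rfl⟩ := List.mem_map.1 he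
    exact Or.inl ⟨0, le_rfl, d, hd, rfl⟩
  | succ i ih =>
    intro e he
    have hP1 := (oddPrime_strictMono i.lt_succ_self).le
    have hP2 := oddPrime_strictMono (i + 1).lt_succ_self
    have hb {n : ℕ} : InBlocks T n → ¬ 8 ∣ n := not_eight_dvd_of_inBlocks hT
    have hm1 : oddPrime i * (i + 1) ≤ oddPrime (i + 1) * (i + 1) := by gcongr
    have hm2 : oddPrime i * i ≤ oddPrime (i + 1) * (i + 1) := by gcongr; omega
    have hm3 : oddPrime i * oddPrime (i + 1) < oddPrime (i + 1) * oddPrime (i + 1 + 1) := by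
      have := (oddPrime_prime (i + 1)).pos
      calc _ ≤ oddPrime (i + 1) * oddPrime (i + 1) := by gcongr
        _ < _ := by gcongr
    rcases List.mem_append.1 he with he | he
    · refine (ih e he).imp (fun ⟨j, hj, h⟩ ↦ ⟨j, by omega, h⟩) (And.imp_right ?_)
      rintro (h | ⟨h, h'⟩ | ⟨h, h'⟩)
      · exact Or.inl (by omega)
      · exact Or.inr (Or.inl ⟨h, by omega⟩)
      · exact Or.inr (Or.inr ⟨h, by omega⟩)
    rcases List.mem_append.1 he with he | he
    · right
      rw [connector] at he
      split_ifs at he with hc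
      · rw [List.mem_singleton] at he
        subst he
        refine ⟨fun h ↦ hb h ⟨2 * (oddPrime i * oddPrime (i + 1)), by ring⟩,
          Or.inr (Or.inr ⟨?_, by omega⟩)⟩
        exact not_dvd_sixteen_mul i
      · push Not at hc
        simp only [List.mem_cons, List.not_mem_nil, or_false] at he
        rcases he with rfl | rfl | rfl
        · exact ⟨fun h ↦ hb h (by omega), Or.inr (Or.inl ⟨dvd_mul_right _ _, by omega⟩)⟩
        · exact ⟨hc.1, Or.inl le_rfl⟩
        · exact ⟨fun h ↦ hb h (by omega), Or.inr (Or.inl ⟨dvd_mul_right _ _, by omega⟩)⟩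
    · obtain ⟨d, hd, rfl⟩ := List.mem_map.1 he
      exact Or.inl ⟨i + 1, le_rfl, d, hd, rfl⟩

theorem le_of_mem_chainPrefix {T : ℕ → List ℕ}
    (hT : ∀ i, IsSmoothChain (oddPrime i) (oddPrime i) (T i)) {i e : ℕ}
    (he : e ∈ chainPrefix T i) : e ≤ 32 * oddPrime i ^ 2 := by
  have h1 := lt_oddPrime i
  have h2 := oddPrime_succ_le i
  rcases isPrefixMember_of_mem_chainPrefix hT i e he with
    ⟨j, hj, d, hd, rfl⟩ | ⟨-, h | ⟨-, h⟩ | ⟨-, h⟩⟩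
  · have h3 := oddPrime_strictMono.monotone hj
    have h4 := (hT j).le d hd
    rw [max_eq_left (two_lt_oddPrime j).le] at h4
    nlinarith [Nat.mul_le_mul h3 (h4.trans h3)]
  · nlinarith
  · nlinarith
  · nlinarith

theorem IsPrefixMember.exists_of_inBlocks {T : ℕ → List ℕ} {i e : ℕ} (h : IsPrefixMember T i e)
    (hb : InBlocks T e) : ∃ j ≤ i, ∃ d ∈ T j, oddPrime j * d = e :=
  h.resolve_right fun h ↦ h.1 hb

theorem nodup_connector (T : ℕ → List ℕ) (l : List ℕ) (i : ℕ) : (connector T l i).Nodup := by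
  have hP1 := oddPrime_strictMono i.lt_succ_self
  have h1 : oddPrime i * (i + 1) < oddPrime (i + 1) * (i + 1) := by gcongr
  have h2 : i + 1 ≤ oddPrime i * (i + 1) := Nat.le_mul_of_pos_left _ (oddPrime_prime i).pos
  rw [connector]
  split_ifs
  · simp
  · simp only [List.nodup_cons, List.mem_cons, List.not_mem_nil, or_false, not_or,
      List.nodup_nil, not_false_eq_true, and_true]
    omega

theorem not_inBlocks_of_mem_connector {T : ℕ → List ℕ}
    (hT : ∀ i, IsSmoothChain (oddPrime i) (oddPrime i) (T i)) {l : List ℕ} {i e : ℕ}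
    (he : e ∈ connector T l i) : ¬ InBlocks T e := by
  have hb {n : ℕ} : InBlocks T n → ¬ 8 ∣ n := not_eight_dvd_of_inBlocks hT
  rw [connector] at he
  split_ifs at he with hc
  · rw [List.mem_singleton] at he
    exact fun h ↦ hb h (by omega)
  · push Not at hc
    simp only [List.mem_cons, List.not_mem_nil, or_false] at he
    rcases he with rfl | rfl | rfl
    · exact fun h ↦ hb h (by omega)
    · exact hc.1
    · exact fun h ↦ hb h (by omega)

theorem nodup_chainPrefix {T : ℕ → List ℕ}
    (hT : ∀ i, IsSmoothChain (oddPrime i) (oddPrime i) (T i)) (i : ℕ) :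
    (chainPrefix T i).Nodup := by
  have hmap (i : ℕ) : ((T i).map (oddPrime i * ·)).Nodup :=
    (hT i).nodup.map fun a b hab ↦ Nat.eq_of_mul_eq_mul_left (oddPrime_prime i).pos hab
  induction i with
  | zero => exact hmap 0
  | succ i ih =>
    have hinv := isPrefixMember_of_mem_chainPrefix hT i
    rw [chainPrefix, List.nodup_append, List.nodup_append]
    refine ⟨ih, ⟨nodup_connector _ _ _, hmap _, ?_⟩, ?_⟩
    · rintro x hx z hz rfl
      obtain ⟨d, hd, rfl⟩ := List.mem_map.1 hz
      exact not_inBlocks_of_mem_connector hT hx ⟨i + 1, d, hd, rfl⟩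
    rintro x hx z hz rfl
    rcases List.mem_append.1 hz with hz | hz
    · have hnb := not_inBlocks_of_mem_connector hT hz
      have h := (hinv x hx).resolve_left fun ⟨j, _, d, hd, h⟩ ↦ hnb ⟨j, d, hd, h⟩
      have hP := oddPrime_strictMono i.lt_succ_self
      have h1 : oddPrime i * (i + 1) < oddPrime (i + 1) * (i + 1) := by gcongr
      have h2 : i + 1 ≤ oddPrime i * (i + 1) := Nat.le_mul_of_pos_left _ (oddPrime_prime i).pos
      have h3 : oddPrime i * (i + 1) = oddPrime i * i + oddPrime i := by ring
      have h4 := two_lt_oddPrime i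
      have h5 := lt_oddPrime i
      have h6 : oddPrime i ≤ oddPrime i * oddPrime (i + 1) :=
        Nat.le_mul_of_pos_right _ (oddPrime_prime _).pos
      rw [connector] at hz
      split_ifs at hz with hc
      · rw [List.mem_singleton] at hz
        subst hz
        rcases h.2 with h | ⟨h, -⟩ | ⟨-, h⟩
        · omega
        · exact not_dvd_sixteen_mul i h
        · exact h.false
      · push Not at hc
        simp only [List.mem_cons, List.not_mem_nil, or_false] at hz
        rcases hz with rfl | rfl | rfl
        · omega
        · exact hc.2 hx
        · omega
    · obtain ⟨d, hd, rfl⟩ := List.mem_map.1 hz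
      obtain ⟨j, hj, d', hd', h⟩ := (hinv _ hx).exists_of_inBlocks ⟨i + 1, d, hd, rfl⟩
      have := oddPrime_mul_injOn hT hd' hd h
      omega

theorem getLast?_chainPrefix {T : ℕ → List ℕ} (hT2 : ∀ i, (T i).getLast? = some 2) (i : ℕ) :
    (chainPrefix T i).getLast? = some (oddPrime i * 2) := by
  cases i <;> simp [chainPrefix, List.getLast?_append, hT2]

theorem isChain_chainPrefix {T : ℕ → List ℕ}
    (hT : ∀ i, IsSmoothChain (oddPrime i) (oddPrime i) (T i))
    (hT2 : ∀ i, (T i).getLast? = some 2) (i : ℕ) : (chainPrefix T i).IsChain DvdComparable := by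
  induction i with
  | zero => exact (hT 0).isChain.map_mul_left _
  | succ i ih =>
    have hlast := getLast?_chainPrefix hT2 i
    have hhead : ((T (i + 1)).map (oddPrime (i + 1) * ·)).head? = some (oddPrime (i + 1)) := by
      simp [(hT (i + 1)).head]
    rw [chainPrefix, List.isChain_append, List.isChain_append]
    refine ⟨ih, ⟨?_, (hT (i + 1)).isChain.map_mul_left _, fun x hx z hz ↦ ?_⟩, fun x hx z hz ↦ ?_⟩
    · rw [connector]
      split_ifs
      · simp
      · simp only [List.isChain_cons_cons, List.isChain_singleton, and_true]
        exact ⟨Or.inr ⟨32 * oddPrime i, by ring⟩, Or.inl ⟨32 * oddPrime (i + 1), by ring⟩⟩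
    · rw [hhead] at hz
      cases hz
      rw [connector] at hx
      split_ifs at hx
      · obtain rfl : 16 * (oddPrime i * oddPrime (i + 1)) = x := by simpa using hx
        exact Or.inr ⟨16 * oddPrime i, by ring⟩
      · obtain rfl : 32 * (oddPrime (i + 1) * (i + 1)) = x := by simpa using hx
        exact Or.inr ⟨32 * (i + 1), by ring⟩
    · rw [hlast] at hx
      cases hx
      rw [connector] at hz
      split_ifs at hz
      · cases hz
        exact Or.inl ⟨8 * oddPrime (i + 1), by ring⟩
      · cases hz
        exact Or.inl ⟨16 * (i + 1), by ring⟩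

theorem pos_of_mem_chainPrefix {T : ℕ → List ℕ}
    (hT : ∀ i, IsSmoothChain (oddPrime i) (oddPrime i) (T i)) (i : ℕ) :
    ∀ e ∈ chainPrefix T i, 0 < e := by
  have hmap (i : ℕ) : ∀ e ∈ (T i).map (oddPrime i * ·), 0 < e := by
    intro e he
    obtain ⟨d, hd, rfl⟩ := List.mem_map.1 he
    exact Nat.mul_pos (oddPrime_prime i).pos ((hT i).pos d hd)
  induction i with
  | zero => exact hmap 0
  | succ i ih =>
    intro e he
    rcases List.mem_append.1 he with he | he
    · exact ih e he
    rcases List.mem_append.1 he with he | he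
    · have := (oddPrime_prime i).pos
      have := (oddPrime_prime (i + 1)).pos
      rw [connector] at he
      split_ifs at he
      · rw [List.mem_singleton] at he
        subst he
        positivity
      · simp only [List.mem_cons, List.not_mem_nil, or_false] at he
        rcases he with rfl | rfl | rfl <;> positivity
    · exact hmap (i + 1) e he

theorem exists_mem_chainPrefix (T : ℕ → List ℕ) (n : ℕ) : ∃ i, n + 1 ∈ chainPrefix T i := by
  by_cases h : InBlocks T (n + 1)
  · obtain ⟨i, d, hd, h⟩ := h
    rw [← h]
    refine ⟨i, ?_⟩
    have h1 : oddPrime i * d ∈ (T i).map (oddPrime i * ·) := List.mem_map.2 ⟨d, hd, rfl⟩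
    cases i with
    | zero => exact h1
    | succ i => exact List.mem_append_right _ (List.mem_append_right _ h1)
  by_cases h' : n + 1 ∈ chainPrefix T n
  · exact ⟨n, h'⟩
  · refine ⟨n + 1, List.mem_append_right _ (List.mem_append_left _ ?_)⟩
    rw [connector, if_neg (not_or.2 ⟨h, h'⟩)]
    simp

theorem sum_length_le (T : ℕ → List ℕ) (i : ℕ) :
    ∑ j ∈ Finset.range (i + 1), (T j).length ≤ (chainPrefix T i).length := by
  induction i with
  | zero => simp [chainPrefix]
  | succ i ih =>
    rw [Finset.sum_range_succ, chainPrefix]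
    simp only [List.length_append, List.length_map]
    omega

theorem lt_length_chainPrefix {T : ℕ → List ℕ} (hT2 : ∀ i, (T i).getLast? = some 2) (i : ℕ) :
    i < (chainPrefix T i).length := by
  refine lt_of_lt_of_le ?_ (sum_length_le T i)
  have h (j : ℕ) : 1 ≤ (T j).length := List.length_pos_iff.2 fun h ↦ by simpa [h] using hT2 j
  calc i < ∑ j ∈ Finset.range (i + 1), 1 := by simp
    _ ≤ _ := Finset.sum_le_sum fun j _ ↦ h j

theorem card_mul_le_length_chainPrefix {T : ℕ → List ℕ} {i : ℕ} {b : ℝ} (hb : 0 ≤ b)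
    (S : Finset ℕ) (hS : ∀ p ∈ S, p.Prime ∧ 2 < p ∧ p ≤ oddPrime i)
    (h : ∀ j, oddPrime j ∈ S → b ≤ (T j).length) :
    S.card * b ≤ (chainPrefix T i).length := by
  classical
  set J : Finset ℕ := (Finset.range (i + 1)).filter fun j ↦ oddPrime j ∈ S
  have h1 : S.card ≤ J.card := by
    refine (Finset.card_le_card (t := J.image oddPrime) fun p hp ↦ ?_).trans Finset.card_image_le
    obtain ⟨hp1, hp2, hp3⟩ := hS p hp
    obtain ⟨j, rfl⟩ := exists_oddPrime_eq hp1 hp2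
    have := oddPrime_strictMono.le_iff_le.1 hp3
    exact Finset.mem_image.2 ⟨j, Finset.mem_filter.2 ⟨Finset.mem_range.2 (by omega), hp⟩, rfl⟩
  calc (S.card : ℝ) * b ≤ J.card * b := by gcongr
    _ = ∑ j ∈ J, b := by simp
    _ ≤ ∑ j ∈ J, ((T j).length : ℝ) := by
      gcongr with j hj
      exact h j (Finset.mem_filter.1 hj).2
    _ ≤ ∑ j ∈ Finset.range (i + 1), ((T j).length : ℝ) :=
      Finset.sum_le_sum_of_subset_of_nonneg (Finset.filter_subset _ _) fun _ _ _ ↦ by positivity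
    _ ≤ _ := by exact_mod_cast sum_length_le T i

theorem CoversGapDense.card_le_length {t X : ℕ} {l : List ℕ} (h : CoversGapDense t X X l)
    (ht : 0 < t) (hX : 0 < X) :
    (gapDenseWindow t (-1) (Real.log (X / (4 * t)))).card ≤ l.length := by
  classical
  refine (Finset.card_le_card fun m hm ↦ ?_).trans l.toFinset_card_le
  obtain ⟨hm, -, hlog⟩ := mem_gapDenseWindow.1 hm
  have ht' : (0 : ℝ) < t := by exact_mod_cast ht
  have hX' : (0 : ℝ) < X := by exact_mod_cast hX
  have hm' : (0 : ℝ) < m := by exact_mod_cast hm.pos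
  have h1 : (m : ℝ) ≤ X / (4 * t) := (Real.log_le_log_iff hm' (by positivity)).1 hlog
  rw [le_div_iff₀ (by positivity)] at h1
  have h2 : 4 * t * m ≤ X := by
    have : (4 * t * m : ℝ) ≤ X := by linarith
    exact_mod_cast this
  refine List.mem_toFinset.2 (h m hm (fun q hq hqm ↦ ?_) h2)
  have h3 := Nat.le_of_dvd hm.pos hqm
  nlinarith

theorem exists_le_length_chainPrefix {t : ℕ} (ht : 3 ≤ t) {c x₀ : ℝ} (hc : 0 < c) (hx₀ : 2 ≤ x₀)
    (hdense : ∀ x, x₀ ≤ x →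
      c * x / Real.log x ≤ (gapDenseWindow t (-1) (Real.log x)).card) :
    ∃ C X₀ : ℝ, 0 < C ∧ 2 ≤ X₀ ∧ ∀ T : ℕ → List ℕ,
      (∀ i, CoversGapDense t (oddPrime i) (oddPrime i) (T i)) → ∀ i, X₀ ≤ oddPrime i →
        C * oddPrime i ^ 2 / Real.log (oddPrime i) ^ 2 ≤ (chainPrefix T i).length := by
  obtain ⟨x₁, hx₁, hpi⟩ := exists_le_card_primesIoc
  have ht' : (3 : ℝ) ≤ t := by exact_mod_cast ht
  refine ⟨c / (128 * t), x₁ + 32 * t * x₀, by positivity, ?_, fun T hT i hi ↦ ?_⟩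
  · nlinarith
  have htx : 6 ≤ t * x₀ := by nlinarith
  set P : ℝ := (oddPrime i : ℝ) with hP
  have hP32 : 32 * t * x₀ ≤ P := by linarith
  have hP1 : 1 < P := by nlinarith
  have hlog : 0 < Real.log P := Real.log_pos hP1
  have h1 := hpi (P / 8) P (by positivity) le_rfl (by nlinarith)
  have h2 : ((primesIoc (P / 8) P).card : ℝ) * (c * P / (32 * t * Real.log P)) ≤
      (chainPrefix T i).length := by
    refine card_mul_le_length_chainPrefix (by positivity) _ (fun p hp ↦ ?_) fun j hj ↦ ?_
    · obtain ⟨hp1, hp2, hp3⟩ := (mem_primesIoc (by positivity)).1 hp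
      refine ⟨hp1, ?_, Nat.cast_le.1 hp3⟩
      have : (2 : ℝ) < p := by nlinarith
      exact_mod_cast this
    · obtain ⟨-, hj2, hj3⟩ := (mem_primesIoc (by positivity)).1 hj
      have h3 := (hT j).card_le_length (by omega) (oddPrime_prime j).pos
      have h4 : x₀ ≤ oddPrime j / (4 * t) := by
        rw [le_div_iff₀ (by positivity)]
        nlinarith
      refine le_trans ?_ ((hdense _ h4).trans (by exact_mod_cast h3))
      have h5 : Real.log (oddPrime j / (4 * t)) ≤ Real.log P := by
        refine Real.log_le_log (by linarith) (le_trans (div_le_self (by positivity) ?_) hj3)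
        linarith
      have h6 : 0 < Real.log (oddPrime j / (4 * t)) := Real.log_pos (by linarith)
      calc c * P / (32 * t * Real.log P) = c * (P / 8 / (4 * t)) / Real.log P := by
            field_simp
            norm_num
        _ ≤ c * (oddPrime j / (4 * t)) / Real.log (oddPrime j / (4 * t)) := by
            gcongr
  refine le_trans ?_ h2
  calc c / (128 * t) * P ^ 2 / Real.log P ^ 2 =
        (P / 4) / Real.log P * (c * P / (32 * t * Real.log P)) := by
          field_simp
          norm_num
    _ ≤ _ := by
        gcongr
        rwa [div_le_iff₀ hlog]

theorem sq_le_mul_log_sq {c P n : ℝ} (hc : 0 < c) (hP : 1 < P) (hcP : 16 ≤ c ^ 2 * P)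
    (hn : c * P ^ 2 / Real.log P ^ 2 ≤ n) : P ^ 2 ≤ 4 / c * n * Real.log n ^ 2 := by
  have hlog : 0 < Real.log P := Real.log_pos hP
  have h1 : Real.log P ^ 2 ≤ 4 * P := by
    have h2 := Real.log_le_sub_one_of_pos (Real.sqrt_pos.2 (zero_lt_one.trans hP))
    rw [Real.log_sqrt (by linarith)] at h2
    have h3 := Real.sq_sqrt (zero_le_one.trans hP.le)
    nlinarith [Real.sqrt_nonneg P]
  rw [div_le_iff₀ (by positivity)] at hn
  have hn0 : 0 < n := by
    by_contra h
    nlinarith [sq_nonneg (Real.log P), mul_pos hc (pow_pos (zero_lt_one.trans hP) 2)]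
  have h4 : c * P ≤ 4 * n := by
    have : c * P * P ≤ 4 * n * P := by nlinarith
    exact le_of_mul_le_mul_right this (by linarith)
  have h5 : P ≤ n ^ 2 := by
    have h6 : (c * P) ^ 2 ≤ (4 * n) ^ 2 := by gcongr
    have h7 : 16 * P ≤ c ^ 2 * P * P := by gcongr
    nlinarith
  have h8 : Real.log P ≤ 2 * Real.log n := by
    have := Real.log_le_log (by linarith) h5
    rwa [Real.log_pow] at this
  rw [div_mul_eq_mul_div, div_mul_eq_mul_div, le_div_iff₀ hc]
  have h9 : Real.log P ^ 2 ≤ (2 * Real.log n) ^ 2 := by gcongr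
  calc P ^ 2 * c ≤ n * Real.log P ^ 2 := by linarith
    _ ≤ n * (2 * Real.log n) ^ 2 := by gcongr
    _ = _ := by ring

theorem chain_permutation_nlogsq :
    ∃ c : ℝ, 0 < c ∧ ∃ f : ℕ+ → ℕ+, Function.Bijective f ∧
      (∀ n : ℕ+, f n ∣ f (n + 1) ∨ f (n + 1) ∣ f n) ∧
      ∀ n : ℕ+, 2 ≤ n →
        ((f n : ℕ) : ℝ) ≤ c * ((n : ℕ) : ℝ) * (Real.log ((n : ℕ) : ℝ)) ^ 2 := by
  obtain ⟨t, ht, c, x₀, hc, hx₀, hdense⟩ := exists_le_card_gapDenseWindow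
  choose T hT hT2 hcov using fun i ↦ exists_isSmoothChain t (oddPrime i) (oddPrime i)
  obtain ⟨C, X₀, hC, hX₀, hlen⟩ := exists_le_length_chainPrefix ht hc hx₀ hdense
  replace hlen := hlen T hcov
  obtain ⟨f, hf, hfchain, hfmem⟩ := exists_bijective_of_isPrefix_succ
    (R := DvdComparable) (L := chainPrefix T) (fun i ↦ List.prefix_append _ _)
    (lt_length_chainPrefix hT2)
    (nodup_chainPrefix hT) (isChain_chainPrefix hT hT2) (pos_of_mem_chainPrefix hT)
    (exists_mem_chainPrefix T)
  have hfle : ∀ (n : ℕ+) i, (n : ℕ) ≤ (chainPrefix T i).length →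
      ((f n : ℕ) : ℝ) ≤ 32 * (oddPrime i : ℝ) ^ 2 := fun n i h ↦ by
    exact_mod_cast le_of_mem_chainPrefix hT (hfmem n i h)
  set B : ℝ := 32 * (oddPrime 0 : ℝ) ^ 2 + 128 * (X₀ + 16 / C ^ 2) ^ 2 with hB
  have hB0 : 0 < B := by positivity
  have hlog2 : 0 < Real.log 2 := Real.log_pos one_lt_two
  refine ⟨B / Real.log 2 ^ 2 + 512 / C, by positivity, f, hf,
    fun n ↦ (hfchain n).imp PNat.dvd_iff.2 PNat.dvd_iff.2, fun n hn ↦ ?_⟩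
  have hn2 : (2 : ℝ) ≤ n := by exact_mod_cast hn
  have hlogn : Real.log 2 ≤ Real.log n := Real.log_le_log two_pos hn2
  have hsmall : ((f n : ℕ) : ℝ) ≤ B → ((f n : ℕ) : ℝ) ≤
      (B / Real.log 2 ^ 2 + 512 / C) * n * Real.log n ^ 2 := fun h ↦ by
    calc ((f n : ℕ) : ℝ) ≤ B / Real.log 2 ^ 2 * 1 * Real.log 2 ^ 2 := by
          field_simp
          exact h
      _ ≤ (B / Real.log 2 ^ 2 + 512 / C) * n * Real.log n ^ 2 := by
          gcongr
          · linarith [show 0 ≤ 512 / C by positivity]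
          · linarith
  have hex : ∃ i, (n : ℕ) ≤ (chainPrefix T i).length := ⟨n, (lt_length_chainPrefix hT2 n).le⟩
  classical
  have hspec := Nat.find_spec hex
  have hmin := fun k ↦ Nat.find_min hex (m := k)
  rcases hi : Nat.find hex with - | i
  · rw [hi] at hspec
    refine hsmall ((hfle n 0 hspec).trans ?_)
    rw [hB]
    linarith [sq_nonneg (X₀ + 16 / C ^ 2)]
  rw [hi] at hspec
  have hlt := hmin i (by omega)
  push Not at hlt
  have hle : ((f n : ℕ) : ℝ) ≤ 128 * (oddPrime i : ℝ) ^ 2 := by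
    refine (hfle n _ hspec).trans ?_
    have h : (oddPrime (i + 1) : ℝ) ≤ 2 * oddPrime i := by exact_mod_cast oddPrime_succ_le i
    calc 32 * (oddPrime (i + 1) : ℝ) ^ 2 ≤ 32 * (2 * oddPrime i) ^ 2 := by gcongr
      _ = _ := by ring
  rcases le_total (oddPrime i : ℝ) (X₀ + 16 / C ^ 2) with h | h
  · refine hsmall (hle.trans ?_)
    have : (oddPrime i : ℝ) ^ 2 ≤ (X₀ + 16 / C ^ 2) ^ 2 := by gcongr
    rw [hB]
    linarith [sq_nonneg (oddPrime 0 : ℝ)]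
  have h16 : 0 < 16 / C ^ 2 := by positivity
  have hn' : ((chainPrefix T i).length : ℝ) ≤ n := by exact_mod_cast hlt.le
  have h1 := sq_le_mul_log_sq hC (by linarith) (by
    have : 16 / C ^ 2 ≤ oddPrime i := by linarith
    rwa [div_le_iff₀ (by positivity), mul_comm] at this) ((hlen i (by linarith)).trans hn')
  calc ((f n : ℕ) : ℝ) ≤ 128 * (4 / C * n * Real.log n ^ 2) := hle.trans (by gcongr)
    _ = (512 / C) * n * Real.log n ^ 2 := by ring
    _ ≤ _ := by
      gcongr
      linarith [show 0 ≤ B / Real.log 2 ^ 2 by positivity]
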